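/- arXiv:1112.5072 — 6 statements merged into one kernel-verified Lean document; each statement's English description precedes it below -/
import Mathlib

section
/- For every integer b ≥ 2, the irrationality exponent of G(1/b) equals 2, where G(z) = Σ_{n≥0} z^{2^n}/(1 − z^{2^n}). -/
/-- The irrationality exponent of a real number `α`: the supremum of the set of real
numbers `μ` such that `|α - p/q| < 1/q^μ` has infinitely many solutions `(p, q)` with
`p` an integer and `q` a positive integer. -/
noncomputable def irrationalityExponent (α : ℝ) : ℝ :=
  sSup {μ : ℝ |
    {pq : ℤ × ℕ | 0 < pq.2 ∧ |α - (pq.1 : ℝ) / (pq.2 : ℝ)| < 1 / (pq.2 : ℝ) ^ μ}.Infinite}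


namespace GExp
open Polynomial

def a (n : ℕ) : ℕ := if n = 0 then 0 else padicValNat 2 n + 1

lemma a_zero : a 0 = 0 := by simp [a]
lemma a_odd (n : ℕ) : a (2 * n + 1) = 1 := by
  have : ¬ 2 ∣ 2 * n + 1 := by omega
  simp [a, padicValNat.eq_zero_of_not_dvd this]
lemma a_even (n : ℕ) (hn : n ≠ 0) : a (2 * n) = a n + 1 := by
  have := padicValNat.mul (p := 2) (a := 2) (b := n) (by norm_num) hn
  simp [a, hn, this]
  omega
lemma a_le (n : ℕ) : a n ≤ n + 1 := by
  unfold a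
  split_ifs
  · omega
  · have := padicValNat_le_nat_log (p := 2) n
    have := Nat.log_le_self 2 n
    omega

noncomputable def g (R : Type) [CommRing R] : PowerSeries R := PowerSeries.mk fun n => (a n : R)

lemma sq_coeff (f : PowerSeries (ZMod 2)) (n : ℕ) :
    PowerSeries.coeff n (f ^ 2) = if Even n then PowerSeries.coeff (n / 2) f else 0 := by
  have h := MvPowerSeries.map_frobenius_expand (R := ZMod 2) 2 (by norm_num) (f := f)
  rw [ZMod.frobenius_zmod] at h
  have h' : PowerSeries.expand 2 (by norm_num) f = f ^ 2 := by
    rw [← h]; simp [PowerSeries.expand]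
  rw [← h', PowerSeries.coeff_expand]
  simp [even_iff_two_dvd]

lemma g_rel : (1 + PowerSeries.X) * (g (ZMod 2) ^ 2 + g (ZMod 2)) = PowerSeries.X := by
  have h : g (ZMod 2) ^ 2 + g (ZMod 2) = PowerSeries.mk fun n => if n = 0 then 0 else 1 := by
    ext n
    rw [map_add, sq_coeff]
    rcases Nat.even_or_odd' n with ⟨m, rfl | rfl⟩
    · by_cases hm : m = 0
      · simp [hm, g, a_zero]
      · simp [g, hm, a_even m hm]
        rw [← add_assoc, CharTwo.add_self_eq_zero, zero_add]
    · simp [g, a_odd]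
  rw [h]
  ext n
  rw [add_mul, one_mul, map_add]
  rcases n with _ | _ | n
  · simp
  · simp [PowerSeries.coeff_succ_X_mul]
  · simp [PowerSeries.coeff_succ_X_mul, PowerSeries.coeff_X]
    decide

lemma prime_p : Prime (1 + X : (ZMod 2)[X]) := by
  have : (1 + X : (ZMod 2)[X]) = X - C 1 := by
    rw [CharTwo.sub_eq_add]; simp [add_comm]
  rw [this]; exact prime_X_sub_C 1

lemma not_p_dvd_X : ¬ (1 + X : (ZMod 2)[X]) ∣ X := by
  intro h
  have h1 : (1 + X : (ZMod 2)[X]) ∣ 1 := by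
    have := dvd_sub (dvd_refl (1 + X : (ZMod 2)[X])) h
    simpa using this
  exact prime_p.not_isUnit (isUnit_of_dvd_one h1)

lemma descent (n : ℕ) : ∀ A B : (ZMod 2)[X], A.natDegree < n →
    A ^ 2 * X = (1 + X) * (B * (A + B)) → A = 0 := by
  induction n with
  | zero => intro A B h; omega
  | succ n ih =>
    intro A B hd h
    have p0 : (1 + X : (ZMod 2)[X]) ≠ 0 := prime_p.ne_zero
    have hA : (1 + X) ∣ A := by
      have : (1 + X) ∣ A ^ 2 * X := ⟨_, h⟩
      rcases prime_p.dvd_or_dvd this with h1 | h1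
      · exact prime_p.dvd_of_dvd_pow h1
      · exact absurd h1 not_p_dvd_X
    obtain ⟨A', rfl⟩ := hA
    have h2 : (1 + X) * A' ^ 2 * X = B * ((1 + X) * A' + B) := by
      apply mul_left_cancel₀ p0
      rw [← h]; ring
    have hB : (1 + X) ∣ B := by
      have : (1 + X) ∣ B ^ 2 := by
        refine ⟨A' ^ 2 * X - B * A', ?_⟩
        linear_combination -h2
      exact prime_p.dvd_of_dvd_pow this
    obtain ⟨B', rfl⟩ := hB
    have h3 : A' ^ 2 * X = (1 + X) * (B' * (A' + B')) := by
      apply mul_left_cancel₀ p0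
      linear_combination h2
    by_cases hA0 : A' = 0
    · simp [hA0]
    have hdeg : ((1 + X : (ZMod 2)[X]) * A').natDegree = 1 + A'.natDegree := by
      rw [natDegree_mul p0 hA0]
      congr 1
      rw [add_comm]; exact natDegree_X_add_C 1
    rw [ih A' B' (by omega) h3, mul_zero]

lemma f2_inj (k : ℕ) (A B : (ZMod 2)[X]) (hA : A.natDegree ≤ k) (hB : B.natDegree ≤ k)
    (h : ∀ i < 2 * k + 2, PowerSeries.coeff i ((A : PowerSeries (ZMod 2)) * g (ZMod 2) - (B : PowerSeries (ZMod 2))) = 0) :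
    A = 0 ∧ B = 0 := by
  have hdvd : (PowerSeries.X : PowerSeries (ZMod 2)) ^ (2 * k + 2) ∣
      (A : PowerSeries (ZMod 2)) * g (ZMod 2) - (B : PowerSeries (ZMod 2)) := PowerSeries.X_pow_dvd_iff.2 h
  set P : (ZMod 2)[X] := A ^ 2 * X - (1 + X) * (B * (A + B)) with hP
  have hPe : (P : PowerSeries (ZMod 2)) = ((A : PowerSeries (ZMod 2)) * g (ZMod 2) - (B : PowerSeries (ZMod 2))) *
      ((1 + PowerSeries.X) * ((A : PowerSeries (ZMod 2)) * g (ZMod 2) + (A : PowerSeries (ZMod 2)) + (B : PowerSeries (ZMod 2)))) := by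
    rw [hP]
    push_cast
    linear_combination (-(A : PowerSeries (ZMod 2)) ^ 2) * g_rel
  have hPdvd : (PowerSeries.X : PowerSeries (ZMod 2)) ^ (2 * k + 2) ∣ (P : PowerSeries (ZMod 2)) := by
    rw [hPe]; exact Dvd.dvd.mul_right hdvd _
  have hPdeg : P.natDegree < 2 * k + 2 := by
    have : P.natDegree ≤ 2 * k + 1 := by
      rw [hP]; refine (natDegree_sub_le _ _).trans (max_le ?_ ?_)
      · refine natDegree_mul_le.trans ?_
        have h1 := natDegree_pow_le (p := A) (n := 2)
        have h2 := natDegree_X_le (R := ZMod 2)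
        have := Nat.mul_le_mul_left 2 hA
        omega
      · refine natDegree_mul_le.trans ?_
        have h1 := natDegree_mul_le (p := B) (q := A + B)
        have h2 := natDegree_add_le A B
        have h3 : (1 + X : (ZMod 2)[X]).natDegree = 1 := by
          rw [add_comm]; exact natDegree_X_add_C 1
        omega
    omega
  have hP0 : P = 0 := by
    ext i
    by_cases hi : i < 2 * k + 2
    · have := PowerSeries.X_pow_dvd_iff.1 hPdvd i hi
      simpa using this
    · rw [coeff_eq_zero_of_natDegree_lt (by omega)]; simp
  have hA0 : A = 0 := descent _ A B (Nat.lt_succ_self _) (sub_eq_zero.1 hP0)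
  refine ⟨hA0, ?_⟩
  rw [hP, hA0] at hP0
  have : (1 + X : (ZMod 2)[X]) * (B * B) = 0 := by linear_combination -hP0
  simpa [prime_p.ne_zero] using this


noncomputable def U (R : Type) [CommRing R] (k j : ℕ) : R[X] := if j ≤ k then X ^ j else 0
noncomputable def V (R : Type) [CommRing R] (k j : ℕ) : R[X] := if j ≤ k then 0 else X ^ (j - (k + 1))

noncomputable def M (R : Type) [CommRing R] (k : ℕ) : Matrix (Fin (2 * k + 2)) (Fin (2 * k + 2)) R :=
  fun i j => PowerSeries.coeff (i : ℕ) ((U R k j : PowerSeries R) * g R - (V R k j : PowerSeries R))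

noncomputable def SA (R : Type) [CommRing R] (k : ℕ) (v : Fin (2 * k + 2) → R) : R[X] :=
  ∑ j, C (v j) * U R k j
noncomputable def SB (R : Type) [CommRing R] (k : ℕ) (v : Fin (2 * k + 2) → R) : R[X] :=
  ∑ j, C (v j) * V R k j

lemma M_mulVec (R : Type) [CommRing R] (k : ℕ) (v : Fin (2 * k + 2) → R) (i : Fin (2 * k + 2)) :
    (M R k).mulVec v i = PowerSeries.coeff (i : ℕ)
      ((SA R k v : PowerSeries R) * g R - (SB R k v : PowerSeries R)) := by
  have h : (SA R k v : PowerSeries R) * g R - (SB R k v : PowerSeries R) =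
      ∑ j, PowerSeries.C (v j) * ((U R k j : PowerSeries R) * g R - (V R k j : PowerSeries R)) := by
    have e1 : (SA R k v : PowerSeries R) = ∑ j, PowerSeries.C (v j) * (U R k j : PowerSeries R) := by
      have := map_sum (Polynomial.coeToPowerSeries.ringHom (R := R))
        (fun j : Fin (2 * k + 2) => C (v j) * U R k j) Finset.univ
      refine this.trans (Finset.sum_congr rfl fun j _ => ?_)
      simp
    have e2 : (SB R k v : PowerSeries R) = ∑ j, PowerSeries.C (v j) * (V R k j : PowerSeries R) := by
      have := map_sum (Polynomial.coeToPowerSeries.ringHom (R := R))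
        (fun j : Fin (2 * k + 2) => C (v j) * V R k j) Finset.univ
      refine this.trans (Finset.sum_congr rfl fun j _ => ?_)
      simp
    rw [e1, e2, Finset.sum_mul, ← Finset.sum_sub_distrib]
    exact Finset.sum_congr rfl fun j _ => by ring
  rw [h, map_sum]
  simp only [PowerSeries.coeff_C_mul]
  simp [Matrix.mulVec, dotProduct, M, mul_comm]

lemma SA_deg (R : Type) [CommRing R] (k : ℕ) (v : Fin (2 * k + 2) → R) :
    (SA R k v).natDegree ≤ k := by
  refine natDegree_sum_le_of_forall_le _ _ fun j _ => ?_
  refine (natDegree_C_mul_le _ _).trans ?_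
  unfold U
  split_ifs with h
  · exact (natDegree_X_pow_le _).trans h
  · simp

lemma SB_deg (R : Type) [CommRing R] (k : ℕ) (v : Fin (2 * k + 2) → R) :
    (SB R k v).natDegree ≤ k := by
  refine natDegree_sum_le_of_forall_le _ _ fun j _ => ?_
  refine (natDegree_C_mul_le _ _).trans ?_
  unfold V
  split_ifs with h
  · simp
  · exact (natDegree_X_pow_le _).trans (by omega)

lemma SAB_zero (R : Type) [CommRing R] (k : ℕ) (v : Fin (2 * k + 2) → R)
    (hA : SA R k v = 0) (hB : SB R k v = 0) : v = 0 := by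
  ext i
  by_cases hi : (i : ℕ) ≤ k
  · have := congrArg (fun p => p.coeff (i : ℕ)) hA
    simp only [SA, finsetSum_coeff, coeff_C_mul, coeff_zero] at this
    rw [Finset.sum_eq_single i] at this
    · simpa [U, hi] using this
    · intro j _ hj
      have : (i : ℕ) ≠ j := fun h => hj (Fin.ext h.symm)
      unfold U
      split_ifs <;> simp [coeff_X_pow, this]
    · simp
  · have := congrArg (fun p => p.coeff ((i : ℕ) - (k + 1))) hB
    simp only [SB, finsetSum_coeff, coeff_C_mul, coeff_zero] at this
    rw [Finset.sum_eq_single i] at this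
    · simpa [V, hi] using this
    · intro j _ hj
      have : (i : ℕ) ≠ j := fun h => hj (Fin.ext h.symm)
      unfold V
      split_ifs with h
      · simp
      · have : (i : ℕ) - (k + 1) ≠ j - (k + 1) := by omega
        simp [coeff_X_pow, this]
    · simp

lemma det_ne (k : ℕ) : (M ℤ k).det ≠ 0 := by
  intro h
  have h2 : (M (ZMod 2) k).det = 0 := by
    have : M (ZMod 2) k = (Int.castRingHom (ZMod 2)).mapMatrix (M ℤ k) := by
      ext i j
      have : (U (ZMod 2) k j : PowerSeries (ZMod 2)) * g (ZMod 2) - (V (ZMod 2) k j : PowerSeries (ZMod 2))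
        = PowerSeries.map (Int.castRingHom (ZMod 2))
          ((U ℤ k j : PowerSeries ℤ) * g ℤ - (V ℤ k j : PowerSeries ℤ)) := by
        have hg : g (ZMod 2) = PowerSeries.map (Int.castRingHom (ZMod 2)) (g ℤ) := by
          ext n; simp [g]
        rw [map_sub, map_mul, hg]
        unfold U V
        split_ifs <;> simp
      simp only [M, this, PowerSeries.coeff_map, RingHom.mapMatrix_apply, Matrix.map_apply]
    rw [this, ← RingHom.map_det, h, map_zero]
  obtain ⟨v, hv, hv0⟩ := Matrix.exists_mulVec_eq_zero_iff.2 h2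
  apply hv
  have := f2_inj k _ _ (SA_deg _ k v) (SB_deg _ k v) (fun i hi => by
    rw [← M_mulVec _ k v ⟨i, hi⟩, hv0]; rfl)
  exact SAB_zero _ k v this.1 this.2

lemma pade (k : ℕ) : ∃ (A B : ℤ[X]) (d : ℤ), A.natDegree ≤ k ∧ B.natDegree ≤ k ∧ d ≠ 0 ∧
    ∀ i < 2 * k + 2, PowerSeries.coeff i ((A : PowerSeries ℤ) * g ℤ - (B : PowerSeries ℤ)) =
      if i = 2 * k + 1 then d else 0 := by
  set e : Fin (2 * k + 2) → ℤ := Pi.single ⟨2 * k + 1, by omega⟩ 1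
  set v := (M ℤ k).adjugate.mulVec e with hv
  refine ⟨SA ℤ k v, SB ℤ k v, (M ℤ k).det, SA_deg _ _ _, SB_deg _ _ _, det_ne k, fun i hi => ?_⟩
  rw [← M_mulVec _ k v ⟨i, hi⟩, hv, Matrix.mulVec_mulVec, Matrix.mul_adjugate,
    Matrix.smul_mulVec, Matrix.one_mulVec]
  simp [e, Pi.single_apply]

end GExp
namespace GExp
open Polynomial

noncomputable def H (y : ℝ) : ℝ := ∑' n, (a n : ℝ) * y ^ n
noncomputable def T (M : ℕ) (y : ℝ) : ℝ := ∑' n, (a (n + M) : ℝ) * y ^ n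

lemma summ (M : ℕ) (y : ℝ) (h0 : 0 ≤ y) (h1 : y ≤ 1 / 2) :
    Summable fun n => (a (n + M) : ℝ) * y ^ n := by
  have s1 : Summable fun n : ℕ => ((n : ℝ) ^ 1 * (1 / 2 : ℝ) ^ n + (M + 1) * (1 / 2 : ℝ) ^ n) := by
    refine Summable.add (summable_pow_mul_geometric_of_norm_lt_one 1 (by norm_num)) ?_
    exact (summable_geometric_of_lt_one (by norm_num) (by norm_num)).mul_left _
  refine Summable.of_nonneg_of_le (fun n => by positivity) (fun n => ?_) s1
  have h2 : (a (n + M) : ℝ) ≤ n + M + 1 := by exact_mod_cast a_le (n + M)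
  have h3 : y ^ n ≤ (1 / 2) ^ n := pow_le_pow_left₀ h0 h1 n
  calc (a (n + M) : ℝ) * y ^ n ≤ (n + M + 1) * (1 / 2) ^ n := by gcongr
    _ = _ := by ring

lemma T_nonneg (M : ℕ) (y : ℝ) (h0 : 0 ≤ y) : 0 ≤ T M y :=
  tsum_nonneg fun n => by positivity

lemma T_le (M : ℕ) (y : ℝ) (h0 : 0 ≤ y) (h1 : y ≤ 1 / 2) : T M y ≤ T M (1 / 2) := by
  refine Summable.tsum_le_tsum (fun n => ?_) (summ M y h0 h1) (summ M _ (by norm_num) le_rfl)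
  gcongr

lemma H_split (M : ℕ) (y : ℝ) (h0 : 0 ≤ y) (h1 : y ≤ 1 / 2) :
    H y = ∑ n ∈ Finset.range M, (a n : ℝ) * y ^ n + y ^ M * T M y := by
  have := (summ 0 y h0 h1).sum_add_tsum_nat_add M
  simp only [add_zero] at this
  rw [H, ← this, T, ← tsum_mul_left]
  congr 2
  ext n
  ring

lemma H_func (y : ℝ) (h0 : 0 ≤ y) (h1 : y ≤ 1 / 2) : H y = y / (1 - y) + H (y ^ 2) := by
  have h2 : y ^ 2 ≤ 1 / 2 := by nlinarith
  have e : HasSum (fun n => (a n : ℝ) * (y ^ 2) ^ n) (H (y ^ 2)) := by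
    simpa [H] using (summ 0 (y ^ 2) (by positivity) h2).hasSum
  have q : HasSum (fun n : ℕ => if n = 0 then (0 : ℝ) else y ^ n) (y / (1 - y)) := by
    have := (hasSum_geometric_of_lt_one h0 (by linarith)).mul_left y
    rw [← hasSum_nat_add_iff' 1]
    simpa [pow_succ', div_eq_mul_inv] using this
  have e' : HasSum (fun n : ℕ => if Even n then (a (n / 2) : ℝ) * y ^ n else 0) (H (y ^ 2) + 0) := by
    refine HasSum.even_add_odd ?_ ?_
    · convert e using 2 with n
      simp [pow_mul]
    · convert hasSum_zero using 2 with n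
      simp
  have t := q.add e'
  rw [add_zero] at t
  rw [H, ← t.tsum_eq]
  congr 1
  ext n
  rcases Nat.even_or_odd' n with ⟨m, rfl | rfl⟩
  · by_cases hm : m = 0
    · simp [hm, a_zero]
    · simp [hm, a_even m hm]; ring
  · simp [a_odd]

lemma H_iter (y : ℝ) (h0 : 0 ≤ y) (h1 : y ≤ 1 / 2) (m : ℕ) :
    H y = ∑ n ∈ Finset.range m, y ^ 2 ^ n / (1 - y ^ 2 ^ n) + H (y ^ 2 ^ m) := by
  induction m with
  | zero => simp
  | succ m ih =>
    have h2 : y ^ 2 ^ m ≤ 1 / 2 :=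
      (pow_le_of_le_one h0 (by linarith) (by positivity)).trans h1
    rw [ih, H_func _ (by positivity) h2, Finset.sum_range_succ, ← pow_mul, ← pow_succ]
    ring

lemma H_tsum (y : ℝ) (h0 : 0 ≤ y) (h1 : y ≤ 1 / 2) :
    ∑' n : ℕ, (y ^ 2 ^ n) / (1 - y ^ 2 ^ n) = H y := by
  have hy (m : ℕ) : y ^ 2 ^ m ≤ 1 / 2 :=
      (pow_le_of_le_one h0 (by linarith) (by positivity)).trans h1
  apply HasSum.tsum_eq
  rw [hasSum_iff_tendsto_nat_of_nonneg]
  · have : Filter.Tendsto (fun m : ℕ => H (y ^ 2 ^ m)) Filter.atTop (nhds 0) := by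
      have h3 : Filter.Tendsto (fun m : ℕ => y ^ 2 ^ m * T 1 (1 / 2)) Filter.atTop (nhds 0) := by
        have h4 : Filter.Tendsto (fun m : ℕ => y ^ 2 ^ m) Filter.atTop (nhds 0) :=
          (tendsto_pow_atTop_nhds_zero_of_lt_one h0 (by linarith)).comp
            (tendsto_pow_atTop_atTop_of_one_lt (by norm_num))
        simpa using h4.mul_const (T 1 (1 / 2))
      refine squeeze_zero (fun m => tsum_nonneg fun n => by positivity) (fun m => ?_) h3
      rw [H_split 1 _ (by positivity) (hy m)]
      simp only [Finset.range_one, Finset.sum_singleton, a_zero, pow_one]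
      have := T_le 1 _ (by positivity) (hy m)
      have h5 : 0 ≤ y ^ 2 ^ m := by positivity
      simp only [Nat.cast_zero, zero_mul, zero_add]
      gcongr
    have h6 := (tendsto_const_nhds (x := H y)).sub this
    rw [sub_zero] at h6
    refine h6.congr fun m => ?_
    rw [H_iter y h0 h1 m]; ring
  · intro n
    have := hy n
    exact div_nonneg (by positivity) (by linarith)

lemma poly_bound (P : ℤ[X]) : ∃ C : ℝ, 0 ≤ C ∧ ∀ y : ℝ, 0 ≤ y → y ≤ 1 / 2 → |aeval y P| ≤ C := by
  obtain ⟨C, hC⟩ := (isCompact_Icc (a := (0 : ℝ)) (b := 1 / 2)).exists_bound_of_continuousOn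
    (f := fun y => aeval y P) (P.continuous_aeval.continuousOn)
  refine ⟨C, ?_, fun y h0 h1 => hC y ⟨h0, h1⟩⟩
  exact (norm_nonneg _).trans (hC 0 ⟨le_rfl, by norm_num⟩)

lemma analytic (k : ℕ) : ∃ (A B : ℤ[X]) (C y0 : ℝ), A.natDegree ≤ k ∧ B.natDegree ≤ k ∧ 0 < C ∧
    0 < y0 ∧ y0 ≤ 1 / 2 ∧ ∀ y : ℝ, 0 < y → y ≤ y0 →
      1 / 2 * y ^ (2 * k + 1) ≤ |aeval y A * H y - aeval y B| ∧
      |aeval y A * H y - aeval y B| ≤ C * y ^ (2 * k + 1) ∧ |aeval y A| ≤ C := by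
  obtain ⟨A, B, d, hA, hB, hd, hc⟩ := pade k
  set W : ℤ[X] := A * PowerSeries.trunc (2 * k + 2) (g ℤ) - B - C d * X ^ (2 * k + 1) with hW
  have hWd : X ^ (2 * k + 2) ∣ W := by
    rw [X_pow_dvd_iff]
    intro i hi
    have h1 := hc i hi
    rw [PowerSeries.eq_X_pow_mul_shift_add_trunc (2 * k + 2) (g ℤ)] at h1
    rw [mul_add, map_sub, map_add, mul_left_comm, PowerSeries.coeff_X_pow_mul', if_neg (by omega),
      zero_add, ← Polynomial.coe_mul, Polynomial.coeff_coe, Polynomial.coeff_coe] at h1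
    rw [hW, coeff_sub, coeff_sub, h1, coeff_C_mul, coeff_X_pow]
    split_ifs <;> simp
  obtain ⟨S, hS⟩ := hWd
  obtain ⟨C1, hC1, hb1⟩ := poly_bound S
  obtain ⟨C2, hC2, hb2⟩ := poly_bound A
  set T0 := T (2 * k + 2) (1 / 2)
  have hT0 : 0 ≤ T0 := T_nonneg _ _ (by norm_num)
  set E := C1 + C2 * T0 with hE
  have hE0 : 0 ≤ E := by positivity
  refine ⟨A, B, |(d : ℝ)| + E + C2 + 1, min (1 / 2) (1 / (2 * (E + 1))), hA, hB, by positivity,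
    by positivity, min_le_left _ _, fun y hy hy0 => ?_⟩
  have hy1 : y ≤ 1 / 2 := hy0.trans (min_le_left _ _)
  have hy2 : y ≤ 1 / (2 * (E + 1)) := hy0.trans (min_le_right _ _)
  have key : aeval y A * H y - aeval y B =
      y ^ (2 * k + 1) * (d + y * (aeval y S + aeval y A * T (2 * k + 2) y)) := by
    have h1 := congrArg (aeval y) hS
    have h2 : aeval y (PowerSeries.trunc (2 * k + 2) (g ℤ)) =
        ∑ n ∈ Finset.range (2 * k + 2), (a n : ℝ) * y ^ n := by
      rw [aeval_def, PowerSeries.eval₂_trunc_eq_sum_range]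
      simp [g]
    rw [hW] at h1
    simp only [map_sub, map_mul, map_pow, aeval_X, aeval_C, h2] at h1
    rw [H_split (2 * k + 2) y hy.le hy1]
    have : (algebraMap ℤ ℝ) d = (d : ℝ) := by simp
    rw [this] at h1
    linear_combination h1
  have hr : |aeval y S + aeval y A * T (2 * k + 2) y| ≤ E := by
    refine (abs_add_le _ _).trans ?_
    rw [abs_mul, abs_of_nonneg (T_nonneg _ y hy.le)]
    have := T_le (2 * k + 2) y hy.le hy1
    have := hb1 y hy.le hy1
    have := hb2 y hy.le hy1
    have := T_nonneg (2 * k + 2) y hy.le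
    rw [hE]
    gcongr
  set r := aeval y S + aeval y A * T (2 * k + 2) y
  have hyr : |y * r| ≤ y * E := by
    rw [abs_mul, abs_of_pos hy]; gcongr
  have hyE : y * E ≤ 1 / 2 := by
    rw [le_div_iff₀ (by positivity)] at hy2
    nlinarith
  have hd1 : (1 : ℝ) ≤ |(d : ℝ)| := by
    exact_mod_cast Int.one_le_abs hd
  have hp : 0 < y ^ (2 * k + 1) := by positivity
  rw [key, abs_mul, abs_of_pos hp]
  refine ⟨?_, ?_, ?_⟩
  · rw [mul_comm]
    gcongr
    have := abs_sub_abs_le_abs_add (d : ℝ) (y * r)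
    linarith
  · rw [mul_comm]
    gcongr
    have := abs_add_le (d : ℝ) (y * r)
    nlinarith
  · have := hb2 y hy.le hy1
    have := abs_nonneg (d : ℝ)
    linarith

end GExp

namespace GExp
open Polynomial

lemma int_eval (A : ℤ[X]) (k : ℕ) (hA : A.natDegree ≤ k) (N : ℕ) (hN : 0 < N) :
    ∃ z : ℤ, (z : ℝ) = (N : ℝ) ^ k * aeval (1 / (N : ℝ)) A := by
  refine ⟨∑ i ∈ Finset.range (k + 1), A.coeff i * (N : ℤ) ^ (k - i), ?_⟩
  rw [aeval_eq_sum_range' (Nat.lt_succ_of_le hA), Finset.mul_sum]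
  push_cast
  refine Finset.sum_congr rfl fun i hi => ?_
  have hi' : i ≤ k := by simpa [Nat.lt_succ_iff] using hi
  have hN' : (N : ℝ) ≠ 0 := by positivity
  obtain ⟨j, rfl⟩ := Nat.exists_eq_add_of_le hi'
  simp only [Nat.add_sub_cancel_left, zsmul_eq_mul, one_div, inv_pow, pow_add]
  field_simp

lemma int_sum (b : ℕ) (hb : 2 ≤ b) (m : ℕ) : ∃ z : ℤ, (z : ℝ) = ((b : ℝ) ^ 2 ^ m - 1) *
    ∑ n ∈ Finset.range m, (1 / b : ℝ) ^ 2 ^ n / (1 - (1 / b : ℝ) ^ 2 ^ n) := by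
  have h : ∀ n ∈ Finset.range m, ∃ z : ℤ, (z : ℝ) = ((b : ℝ) ^ 2 ^ m - 1) *
      ((1 / b : ℝ) ^ 2 ^ n / (1 - (1 / b : ℝ) ^ 2 ^ n)) := by
    intro n hn
    obtain ⟨j, rfl⟩ := Nat.exists_eq_add_of_le (Finset.mem_range.1 hn).le
    obtain ⟨z, hz⟩ := sub_dvd_pow_sub_pow ((b : ℤ) ^ 2 ^ n) 1 (2 ^ j)
    refine ⟨z, ?_⟩
    rw [one_pow, ← pow_mul, ← pow_add] at hz
    have hz' : (b : ℝ) ^ 2 ^ (n + j) - 1 = ((b : ℝ) ^ 2 ^ n - 1) * z := by exact_mod_cast hz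
    have hb1 : (1 : ℝ) < (b : ℝ) ^ 2 ^ n :=
      one_lt_pow₀ (by exact_mod_cast hb) (by positivity)
    rw [hz', one_div, inv_pow]
    have h3 : (b : ℝ) ^ 2 ^ n - 1 ≠ 0 := by linarith
    have h4 : (b : ℝ) ^ 2 ^ n ≠ 0 := by linarith
    generalize (b : ℝ) ^ 2 ^ n = x at *
    have h5 : 1 - x⁻¹ ≠ 0 := by
      intro h; apply h3; field_simp at h; simpa using h
    field_simp
  choose! f hf using h
  refine ⟨∑ n ∈ Finset.range m, f n, ?_⟩
  rw [Finset.mul_sum]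
  push_cast
  exact Finset.sum_congr rfl hf

def Phi (b k m : ℕ) (c C : ℝ) : Prop := ∃ P Q : ℤ,
  |(Q : ℝ)| ≤ C * ((b : ℝ) ^ 2 ^ m) ^ (k + 1) ∧
  c / ((b : ℝ) ^ 2 ^ m) ^ k ≤ |Q * H (1 / b) - P| ∧
  |Q * H (1 / b) - P| ≤ C / ((b : ℝ) ^ 2 ^ m) ^ k

lemma Phi_mono {b k m : ℕ} {c C c' C' : ℝ} (h : Phi b k m c C) (hc : c' ≤ c) (hC : C ≤ C') :
    Phi b k m c' C' := by
  obtain ⟨P, Q, h1, h2, h3⟩ := h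
  refine ⟨P, Q, h1.trans ?_, le_trans ?_ h2, h3.trans ?_⟩ <;> gcongr

lemma forms (b : ℕ) (hb : 2 ≤ b) (k : ℕ) :
    ∃ c C : ℝ, ∃ m0 : ℕ, 0 < c ∧ 1 ≤ C ∧ ∀ m ≥ m0, Phi b k m c C := by
  obtain ⟨A, B, C, y0, hA, hB, hC, hy0, hy1, h⟩ := analytic k
  have hb2 : (2 : ℝ) ≤ b := by exact_mod_cast hb
  have hinv : (1 / b : ℝ) ≤ 1 / 2 := one_div_le_one_div_of_le (by norm_num) hb2
  have htend : Filter.Tendsto (fun m : ℕ => (1 / b : ℝ) ^ 2 ^ m) Filter.atTop (nhds 0) :=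
    (tendsto_pow_atTop_nhds_zero_of_lt_one (by positivity) (by linarith)).comp
      (tendsto_pow_atTop_atTop_of_one_lt (by norm_num))
  obtain ⟨m0, hm0⟩ := Filter.eventually_atTop.1 (htend.eventually_le_const hy0)
  refine ⟨1 / 4, C + 1, m0, by norm_num, by linarith, fun m hm => ?_⟩
  obtain ⟨h1, h2, h3⟩ := h _ (by positivity) (hm0 m hm)
  obtain ⟨zA, hzA⟩ := int_eval A k hA (b ^ 2 ^ m) (by positivity)
  obtain ⟨zB, hzB⟩ := int_eval B k hB (b ^ 2 ^ m) (by positivity)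
  obtain ⟨zS, hzS⟩ := int_sum b hb m
  have hit := H_iter (1 / b : ℝ) (by positivity) hinv m
  have hN2 : (2 : ℝ) ≤ (b : ℝ) ^ 2 ^ m :=
    hb2.trans (le_self_pow₀ (by linarith) (by positivity))
  have hyN : (1 / b : ℝ) ^ 2 ^ m = 1 / (b : ℝ) ^ 2 ^ m := by rw [div_pow, one_pow]
  push_cast at hzA hzB
  rw [hyN] at h1 h2 h3 hit
  generalize ∑ n ∈ Finset.range m, (1 / b : ℝ) ^ 2 ^ n / (1 - (1 / b : ℝ) ^ 2 ^ n) = S at *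
  refine ⟨((b : ℤ) ^ 2 ^ m - 1) * zB + zA * zS, ((b : ℤ) ^ 2 ^ m - 1) * zA, ?_⟩
  push_cast
  generalize (b : ℝ) ^ 2 ^ m = N at *
  generalize H (1 / b) = α at *
  rw [hit, hzA, hzB, hzS]
  have key : (N - 1) * (N ^ k * (aeval (1 / N)) A) * (S + H (1 / N)) -
      ((N - 1) * (N ^ k * (aeval (1 / N)) B) + N ^ k * (aeval (1 / N)) A * ((N - 1) * S)) =
      (N - 1) * N ^ k * (aeval (1 / N) A * H (1 / N) - aeval (1 / N) B) := by ring
  rw [key]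
  have hN0 : 0 < N := by linarith
  have hp : 0 < (N - 1) * N ^ k := mul_pos (by linarith) (by positivity)
  have hpow : N ^ k * (1 / N) ^ (2 * k + 1) = 1 / N ^ k / N := by
    rw [div_pow, one_pow, pow_succ, two_mul, pow_add]; field_simp
  have hNk : 0 < 1 / N ^ k := by positivity
  refine ⟨?_, ?_, ?_⟩
  · rw [abs_mul, abs_mul, abs_of_pos (show 0 < N - 1 by linarith),
      abs_of_pos (show 0 < N ^ k by positivity)]
    calc (N - 1) * (N ^ k * |aeval (1 / N) A|) ≤ N * (N ^ k * (C + 1)) := by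
          gcongr <;> linarith
      _ = _ := by ring
  · rw [abs_mul, abs_of_pos hp]
    calc 1 / 4 / N ^ k = N / 2 * (1 / 2) * (1 / N ^ k / N) := by field_simp; norm_num
      _ ≤ (N - 1) * (1 / 2) * (1 / N ^ k / N) := by gcongr; linarith
      _ = (N - 1) * N ^ k * (1 / 2 * (1 / N) ^ (2 * k + 1)) := by rw [← hpow]; ring
      _ ≤ _ := by gcongr
  · rw [abs_mul, abs_of_pos hp]
    calc _ ≤ (N - 1) * N ^ k * (C * (1 / N) ^ (2 * k + 1)) := by gcongr
      _ = (N - 1) * C * (1 / N ^ k / N) := by rw [← hpow]; ring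
      _ ≤ N * (C + 1) * (1 / N ^ k / N) := by gcongr <;> linarith
      _ = _ := by field_simp

lemma forms_unif (b : ℕ) (hb : 2 ≤ b) (n : ℕ) :
    ∃ c C : ℝ, ∃ m0 : ℕ, 0 < c ∧ 1 ≤ C ∧ ∀ k < n, ∀ m ≥ m0, Phi b k m c C := by
  induction n with
  | zero => exact ⟨1, 1, 0, by norm_num, le_rfl, fun k hk => by omega⟩
  | succ n ih =>
    obtain ⟨c, C, m0, hc, hC, h⟩ := ih
    obtain ⟨c', C', m0', hc', hC', h'⟩ := forms b hb n
    refine ⟨min c c', max C C', max m0 m0', lt_min hc hc', hC.trans (le_max_left _ _), ?_⟩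
    intro k hk m hm
    rcases Nat.lt_succ_iff_lt_or_eq.1 hk with h1 | rfl
    · exact Phi_mono (h k h1 m ((le_max_left _ _).trans hm)) (min_le_left _ _) (le_max_left _ _)
    · exact Phi_mono (h' m ((le_max_right _ _).trans hm)) (min_le_right _ _) (le_max_right _ _)

lemma lower (b : ℕ) (hb : 2 ≤ b) (K : ℕ) (hK : 0 < K) :
    ∃ c D : ℝ, ∃ q0 : ℕ, 0 < c ∧ 0 < D ∧ ∀ q : ℕ, q0 ≤ q → 0 < q → ∀ p : ℤ, ∃ w : ℝ, 1 ≤ w ∧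
      w ^ K ≤ D * q ∧ c ≤ |q * H (1 / b) - p| * (q * w ^ 3) := by
  obtain ⟨c, C, m0, hc, hC, h⟩ := forms_unif b hb (2 * K + 1)
  have hb2 : (2 : ℝ) ≤ b := by exact_mod_cast hb
  set D : ℝ := 2 * C * b with hD
  have hD0 : 0 < D := by positivity
  refine ⟨min (1 / 2) (c / D) / (C * D), D, b ^ (K * 2 ^ m0), by positivity, hD0, ?_⟩
  intro q hq hq0 p
  have hq1 : (1 : ℝ) ≤ q := by exact_mod_cast hq0
  obtain ⟨T', hT1, hT2⟩ := exists_nat_pow_near (x := 2 * C * q) (y := (b : ℝ))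
    (by nlinarith) (by linarith)
  set T := T' + 1
  have hTD : (b : ℝ) ^ T ≤ D * q := by
    rw [pow_succ, hD]; nlinarith
  have hTK : K * 2 ^ m0 < T := by
    have h1 : (b : ℝ) ^ (K * 2 ^ m0) ≤ q := by exact_mod_cast hq
    have h2 : (b : ℝ) ^ (K * 2 ^ m0) < (b : ℝ) ^ T := by nlinarith
    exact (pow_lt_pow_iff_right₀ (by linarith)).1 h2
  have hTKne : T / K ≠ 0 := by
    have : K ≤ T := by
      have : 1 ≤ 2 ^ m0 := Nat.one_le_two_pow
      nlinarith
    exact (Nat.div_pos this hK).ne'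
  set m := Nat.log 2 (T / K) with hm
  have hm1 : K * 2 ^ m ≤ T := by
    have := Nat.pow_log_le_self 2 hTKne
    rw [Nat.le_div_iff_mul_le hK] at this
    rw [mul_comm]; exact this
  have hm2 : T < K * 2 ^ (m + 1) := by
    have := Nat.lt_pow_succ_log_self (b := 2) (by norm_num) (T / K)
    rw [Nat.div_lt_iff_lt_mul hK] at this
    rw [mul_comm]; exact this
  have hmm0 : m0 ≤ m := by
    have : K * 2 ^ m0 < K * 2 ^ (m + 1) := hTK.trans hm2
    have := lt_of_mul_lt_mul_left this (Nat.zero_le _)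
    have := (Nat.pow_lt_pow_iff_right (by norm_num : 1 < 2)).1 this
    omega
  have hpm : 0 < 2 ^ m := by positivity
  set k := T / 2 ^ m + 1 with hk
  have hk2 : k < 2 * K + 1 := by
    have : T / 2 ^ m < 2 * K := by
      rw [Nat.div_lt_iff_lt_mul hpm]; rw [pow_succ] at hm2; linarith
    omega
  have hE1 : T ≤ 2 ^ m * k := by
    have := Nat.lt_mul_div_succ T hpm
    exact this.le
  have hE2 : 2 ^ m * k ≤ T + 2 ^ m := by
    rw [hk, mul_add, mul_one]
    have := Nat.mul_div_le T (2 ^ m)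
    omega
  obtain ⟨P, Q, g1, g2, g3⟩ := h k hk2 m hmm0
  have hbT : 0 < (b : ℝ) ^ T := by positivity
  have hNk1 : (b : ℝ) ^ T ≤ ((b : ℝ) ^ 2 ^ m) ^ k := by
    rw [← pow_mul]; exact pow_le_pow_right₀ (by linarith) hE1
  have hNk2 : ((b : ℝ) ^ 2 ^ m) ^ k ≤ (b : ℝ) ^ T * (b : ℝ) ^ 2 ^ m := by
    rw [← pow_mul, ← pow_add]; exact pow_le_pow_right₀ (by linarith) hE2
  have hwK : ((b : ℝ) ^ 2 ^ m) ^ K ≤ (b : ℝ) ^ T := by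
    rw [← pow_mul]; exact pow_le_pow_right₀ (by linarith) (by linarith)
  have hw1 : 1 ≤ (b : ℝ) ^ 2 ^ m := one_le_pow₀ (by linarith)
  refine ⟨(b : ℝ) ^ 2 ^ m, hw1, hwK.trans hTD, ?_⟩
  rw [pow_succ] at g1
  generalize (b : ℝ) ^ 2 ^ m = w at *
  generalize (b : ℝ) ^ T = t at *
  generalize H (1 / b) = α at *
  generalize w ^ k = E at *
  have hE0 : 0 < E := hbT.trans_le hNk1
  have hw0 : 0 < w := by linarith
  have hEb : E ≤ D * q * w := hNk2.trans (by gcongr)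
  have hQ : |(Q : ℝ)| ≤ C * (D * q * w * w) := g1.trans (by gcongr)
  have main : min (1 / 2) (c / D) / w ≤ |(Q : ℝ)| * |q * α - p| := by
    have hid : (Q : ℝ) * (q * α - p) = q * (Q * α - P) + ((q * P - Q * p : ℤ) : ℝ) := by
      push_cast; ring
    rw [← abs_mul, hid]
    by_cases hz : (q * P - Q * p : ℤ) = 0
    · rw [hz, Int.cast_zero, add_zero, abs_mul, abs_of_pos (by linarith : (0 : ℝ) < q)]
      calc min (1 / 2) (c / D) / w ≤ c / D / w := by gcongr; exact min_le_right _ _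
        _ = q * (c / (D * q * w)) := by field_simp
        _ ≤ q * (c / E) := by gcongr
        _ ≤ _ := by gcongr
    · have hone : (1 : ℝ) ≤ |((q * P - Q * p : ℤ) : ℝ)| := by
        exact_mod_cast Int.one_le_abs hz
      have hsm : |(q : ℝ) * (Q * α - P)| ≤ 1 / 2 := by
        rw [abs_mul, abs_of_pos (by linarith : (0 : ℝ) < q)]
        calc q * |Q * α - P| ≤ q * (C / E) := by gcongr
          _ ≤ q * (C / (2 * C * q)) := by gcongr; linarith
          _ = 1 / 2 := by field_simp
      have h1 : min (1 / 2) (c / D) / w ≤ 1 / 2 := by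
        rw [div_le_iff₀ hw0]
        have := min_le_left (1 / 2) (c / D)
        linarith
      have := abs_sub_abs_le_abs_add (((q * P - Q * p : ℤ) : ℝ)) ((q : ℝ) * (Q * α - P))
      rw [add_comm] at this
      linarith
  have m2 : min (1 / 2) (c / D) / w ≤ C * (D * q * w * w) * |q * α - p| := main.trans (by gcongr)
  rw [div_le_iff₀ (by positivity)] at m2 ⊢
  linarith

end GExp

theorem irrationalityExponent_G (b : ℕ) (hb : 2 ≤ b) :
    irrationalityExponent
      (∑' n : ℕ, ((1 / b : ℝ) ^ 2 ^ n) / (1 - (1 / b : ℝ) ^ 2 ^ n)) = 2 := by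
  have hb2 : (2 : ℝ) ≤ b := by exact_mod_cast hb
  have hinv : (1 / b : ℝ) ≤ 1 / 2 := one_div_le_one_div_of_le (by norm_num) hb2
  rw [GExp.H_tsum _ (by positivity) hinv]
  have low := GExp.lower b hb
  generalize GExp.H (1 / b) = α at low
  have hirr : Irrational α := by
    rintro ⟨r, rfl⟩
    obtain ⟨c, D, q0, hc, hD, h⟩ := low 1 one_pos
    obtain ⟨w, -, -, h3⟩ := h (r.den * (q0 + 1)) (by nlinarith [r.pos])
      (Nat.mul_pos r.pos (by omega)) (r.num * (q0 + 1))
    have : (r.den : ℝ) * r = r.num := by exact_mod_cast Rat.den_mul_eq_num r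
    have h0 : ((r.den * (q0 + 1) : ℕ) : ℝ) * (r : ℝ) - ((r.num * (q0 + 1) : ℤ) : ℝ) = 0 := by
      push_cast
      linear_combination ((q0 : ℝ) + 1) * this
    rw [h0, abs_zero, zero_mul] at h3
    linarith
  refine IsGreatest.csSup_eq ⟨?_, ?_⟩
  · have hinf := Real.infinite_rat_abs_sub_lt_one_div_den_sq_of_irrational hirr
    have hinj : Set.InjOn (fun r : ℚ => ((r.num, r.den) : ℤ × ℕ))
        {q : ℚ | |α - q| < 1 / (q.den : ℝ) ^ 2} := by
      intro r _ s _ hrs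
      simp only [Prod.mk.injEq] at hrs
      exact Rat.ext hrs.1 hrs.2
    refine (hinf.image hinj).mono ?_
    rintro _ ⟨r, hr, rfl⟩
    refine ⟨r.pos, ?_⟩
    simp only [Set.mem_ofPred_eq] at hr
    have : ((r.num : ℝ) / (r.den : ℝ)) = r := by exact_mod_cast Rat.num_div_den r
    simp only [this]
    rw [show (2 : ℝ) = ((2 : ℕ) : ℝ) by norm_num, Real.rpow_natCast]
    exact hr
  · intro μ hμ
    by_contra! hlt
    apply hμ
    obtain ⟨K, hK⟩ := exists_nat_gt (4 / (μ - 2))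
    have hμ2 : 0 < μ - 2 := by linarith
    have hK0 : 0 < K := by
      have : (0 : ℝ) < K := lt_trans (by positivity) hK
      exact_mod_cast this
    have hK4 : 4 ≤ (μ - 2) * K := by
      rw [div_lt_iff₀ hμ2] at hK; linarith
    obtain ⟨c, D, q0, hc, hD, h⟩ := low K hK0
    obtain ⟨n, hn⟩ := exists_nat_gt (D ^ 3 / c ^ K)
    set L := max n q0
    obtain ⟨Z, hZ⟩ := exists_nat_gt ((|α| + 1) * L)
    refine Set.Finite.subset ((Set.finite_Icc (-(Z : ℤ)) Z).prod (Set.finite_Iic L)) ?_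
    rintro ⟨p, q⟩ ⟨hq, hpq⟩
    simp only at hq hpq
    have hq1 : (1 : ℝ) ≤ q := by exact_mod_cast hq
    have hqp : (0 : ℝ) < q := by linarith
    have hqL : q ≤ L := by
      by_contra! hqL
      obtain ⟨w, hw1, hwK, hcw⟩ := h q ((le_max_right _ _).trans hqL.le) hq p
      have hn' : (n : ℝ) < q := by exact_mod_cast (le_max_left _ _).trans_lt hqL
      have e1 : |(q : ℝ) * α - p| = q * |α - p / q| := by
        rw [← abs_of_pos hqp, ← abs_mul, abs_of_pos hqp]
        congr 1; field_simp
      rw [e1] at hcw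
      have e2 : c ≤ (q : ℝ) ^ (2 - μ) * w ^ 3 := by
        calc c ≤ _ := hcw
          _ ≤ q * (1 / (q : ℝ) ^ μ) * (q * w ^ 3) := by gcongr
          _ = _ := by
            rw [Real.rpow_sub hqp, Real.rpow_two]; ring
      have e3 : c ^ K ≤ (q : ℝ) ^ (-4 : ℝ) * (D * q) ^ 3 := by
        calc c ^ K ≤ ((q : ℝ) ^ (2 - μ) * w ^ 3) ^ K := by gcongr
          _ = (q : ℝ) ^ ((2 - μ) * K) * (w ^ K) ^ 3 := by
            rw [mul_pow, Real.rpow_mul hqp.le, Real.rpow_natCast, ← pow_mul, ← pow_mul, mul_comm 3]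
          _ ≤ _ := by
            gcongr
            linarith
      have e4 : (q : ℝ) ^ (-4 : ℝ) * (D * q) ^ 3 = D ^ 3 / q := by
        rw [Real.rpow_neg hqp.le, show (4 : ℝ) = ((4 : ℕ) : ℝ) by norm_num, Real.rpow_natCast]
        field_simp
      rw [e4, le_div_iff₀ hqp] at e3
      rw [div_lt_iff₀ (by positivity)] at hn
      have : (n : ℝ) * c ^ K < q * c ^ K := by gcongr
      linarith
    refine ⟨?_, hqL⟩
    have h1 : 1 / (q : ℝ) ^ μ ≤ 1 := by
      rw [div_le_one (by positivity)]
      exact Real.one_le_rpow hq1 (by linarith)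
    have h2 : |(p : ℝ) / q| ≤ |α| + 1 := by
      have := abs_sub_abs_le_abs_sub ((p : ℝ) / q) α
      rw [abs_sub_comm] at this
      linarith
    have h3 : |(p : ℝ)| < Z := by
      rw [abs_div, abs_of_pos hqp, div_le_iff₀ hqp] at h2
      have hqL' : (q : ℝ) ≤ L := by exact_mod_cast hqL
      have : (|α| + 1) * q ≤ (|α| + 1) * L := by gcongr
      linarith
    have h4 : |p| < (Z : ℤ) := by exact_mod_cast h3
    rw [abs_lt] at h4
    exact ⟨h4.1.le, h4.2.le⟩
end

section
/- For every integer b ≥ 2, the irrationality exponent of F(1/b) equals 2, where F(z) = Σ_{n≥0} z^{2^n}/(1 + z^{2^n}). -/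
open Polynomial

/-- Coefficients of `F`. -/
def aCoef (n : ℕ) : ℤ := if n = 0 then 0 else 1 - (padicValNat 2 n : ℤ)

lemma aCoef_zero : aCoef 0 = 0 := rfl
lemma aCoef_odd (k : ℕ) : aCoef (2*k+1) = 1 := by
  have : padicValNat 2 (2*k+1) = 0 := padicValNat.eq_zero_of_not_dvd (by omega)
  simp [aCoef, this]
lemma aCoef_even (k : ℕ) (hk : k ≠ 0) : aCoef (2*k) = aCoef k - 1 := by
  have : padicValNat 2 (2*k) = 1 + padicValNat 2 k := by
    rw [padicValNat.mul (by norm_num) hk]; simp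
  simp [aCoef, this, hk]
lemma aCoef_abs (n : ℕ) : |(aCoef n : ℝ)| ≤ n + 1 := by
  unfold aCoef
  split_ifs with h
  · simp; positivity
  · have h1 : padicValNat 2 n ≤ n := (padicValNat_le_nat_log n).trans (Nat.log_le_self _ _)
    have h2 : (padicValNat 2 n : ℝ) ≤ n := by exact_mod_cast h1
    have h3 : (0:ℝ) ≤ (padicValNat 2 n : ℝ) := Nat.cast_nonneg _
    rw [Int.cast_sub, Int.cast_natCast, Int.cast_one, abs_le]; constructor <;> linarith

lemma aCoef_summable (z : ℝ) (h0 : 0 ≤ z) (h1 : z < 1) :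
    Summable (fun n : ℕ => |(aCoef n : ℝ)| * z ^ n) := by
  have hz : ‖z‖ < 1 := by rwa [Real.norm_of_nonneg h0]
  have s1 := summable_pow_mul_geometric_of_norm_lt_one 1 hz
  have s0 := summable_pow_mul_geometric_of_norm_lt_one 0 hz
  refine Summable.of_nonneg_of_le (fun n => by positivity) (fun n => ?_) (s1.add s0)
  have := mul_le_mul_of_nonneg_right (aCoef_abs n) (pow_nonneg h0 n)
  simpa [add_mul] using this

lemma aCoef_summable' (z : ℝ) (h0 : 0 ≤ z) (h1 : z < 1) :
    Summable (fun n : ℕ => (aCoef n : ℝ) * z ^ n) := by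
  refine Summable.of_norm ?_
  simpa [abs_of_nonneg h0] using aCoef_summable z h0 h1

noncomputable def HH (z : ℝ) : ℝ := ∑' n : ℕ, (aCoef n : ℝ) * z ^ n

lemma HH_eq (z : ℝ) (h0 : 0 ≤ z) (h1 : z < 1) : HH z = z / (1 + z) + HH (z^2) := by
  have hz2 : z^2 < 1 := by nlinarith
  have g := hasSum_geometric_of_lt_one (sq_nonneg z) hz2
  have e : HasSum (fun k : ℕ => (aCoef (2*k) : ℝ) * z^(2*k)) (HH (z^2) - (1 - z^2)⁻¹ + 1) := by
    have := (((aCoef_summable' (z^2) (sq_nonneg z) hz2).hasSum).sub g).add (hasSum_ite_eq 0 (1:ℝ))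
    have e2 : (fun k : ℕ => (aCoef (2*k) : ℝ) * z^(2*k)) = fun b =>
        (aCoef b : ℝ) * (z ^ 2) ^ b - (z ^ 2) ^ b + if b = 0 then 1 else 0 := by
      funext k
      rcases Nat.eq_zero_or_pos k with rfl | hk
      · simp [aCoef_zero]
      · rw [aCoef_even k hk.ne', if_neg hk.ne', ← pow_mul, Int.cast_sub, Int.cast_one]; ring
    rw [e2]; exact this
  have o : HasSum (fun k : ℕ => (aCoef (2*k+1) : ℝ) * z^(2*k+1)) ((1 - z^2)⁻¹ * z) := by
    have := g.mul_right z
    have e2 : (fun k : ℕ => (aCoef (2*k+1) : ℝ) * z^(2*k+1)) = fun i => (z ^ 2) ^ i * z := by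
      funext k
      rw [aCoef_odd, ← pow_mul, Int.cast_one]; ring
    rw [e2]; exact this
  have := (HasSum.even_add_odd (f := fun n : ℕ => (aCoef n : ℝ) * z ^ n) e o).tsum_eq
  have h5 : HH z = _ := this
  rw [h5]
  have h3 : 1 - z^2 ≠ 0 := (by linarith : (0:ℝ) < 1 - z^2).ne'
  have h4 : 1 + z ≠ 0 := (by linarith : (0:ℝ) < 1 + z).ne'
  field_simp
  ring

/-- truncation -/
noncomputable def TT (M : ℕ) : ℤ[X] := ∑ n ∈ Finset.range M, C (aCoef n) * X ^ n

lemma HH_trunc (M : ℕ) : ∃ C : ℝ, 0 < C ∧ ∀ z : ℝ, 0 ≤ z → z ≤ 1/2 →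
    |HH z - aeval z (TT M)| ≤ C * z ^ M := by
  have s := (summable_nat_add_iff M).2 (aCoef_summable (1/2) (by norm_num) (by norm_num))
  refine ⟨2^M * ∑' n : ℕ, |(aCoef (n+M) : ℝ)| * (1/2) ^ (n+M) + 1, by positivity, fun z h0 h1 => ?_⟩
  have hs := aCoef_summable' z h0 (by linarith)
  have hs2 := (summable_nat_add_iff M).2 (aCoef_summable z h0 (by linarith))
  have e : HH z - aeval z (TT M) = ∑' n : ℕ, (aCoef (n+M) : ℝ) * z ^ (n+M) := by
    rw [HH, ← hs.sum_add_tsum_nat_add M]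
    simp [TT]
  rw [e]
  have h2 : |∑' n : ℕ, (aCoef (n+M) : ℝ) * z ^ (n+M)| ≤ ∑' n : ℕ, |(aCoef (n+M) : ℝ)| * z ^ (n+M) := by
    have := norm_tsum_le_tsum_norm (f := fun n : ℕ => (aCoef (n+M) : ℝ) * z ^ (n+M))
      (by simpa [abs_of_nonneg h0] using hs2)
    simpa [abs_of_nonneg h0] using this
  have h3 : ∑' n : ℕ, |(aCoef (n+M) : ℝ)| * z ^ (n+M) ≤
      ∑' n : ℕ, (2^M * z^M) * (|(aCoef (n+M) : ℝ)| * (1/2) ^ (n+M)) := by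
    refine hs2.tsum_le_tsum (fun n => ?_) (s.mul_left _)
    have : z^n ≤ (1/2)^n := pow_le_pow_left₀ h0 h1 n
    have e2 : (2:ℝ)^M * z^M * (|(aCoef (n+M) : ℝ)| * (1/2) ^ (n+M)) = |(aCoef (n+M) : ℝ)| * z^M * (1/2)^n := by
      rw [pow_add (1/2:ℝ)]
      have : (2:ℝ)^M * (1/2)^M = 1 := by rw [← mul_pow]; norm_num
      linear_combination z^M * |(aCoef (n+M) : ℝ)| * (1/2)^n * this
    rw [e2, pow_add]
    have : |(aCoef (n+M) : ℝ)| * z^M * z^n ≤ |(aCoef (n+M) : ℝ)| * z^M * (1/2)^n := by gcongr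
    linarith
  rw [tsum_mul_left] at h3
  have : 0 ≤ z^M := by positivity
  nlinarith

lemma HH_iter (z : ℝ) (h0 : 0 ≤ z) (h1 : z < 1) (m : ℕ) :
    HH z = ∑ n ∈ Finset.range m, z^2^n / (1 + z^2^n) + HH (z^2^m) := by
  induction m with
  | zero => simp
  | succ m ih =>
    rw [ih, HH_eq (z^2^m) (by positivity) (pow_lt_one₀ h0 h1 (by positivity)), Finset.sum_range_succ,
      ← pow_mul, ← pow_succ]
    ring

lemma HH_small : Filter.Tendsto HH (nhdsWithin 0 (Set.Ici 0)) (nhds 0) := by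
  obtain ⟨C, hC, h⟩ := HH_trunc 1
  have hT : ∀ z : ℝ, aeval z (TT 1) = 0 := by intro z; simp [TT, aCoef_zero]
  have ht : Filter.Tendsto (fun z : ℝ => C * z) (nhdsWithin 0 (Set.Ici 0)) (nhds 0) := by
    have : Continuous (fun z : ℝ => C * z) := by fun_prop
    simpa using (this.tendsto 0).mono_left nhdsWithin_le_nhds
  refine squeeze_zero_norm' ?_ ht
  have : ∀ᶠ z : ℝ in nhdsWithin 0 (Set.Ici 0), z ≤ 1/2 :=
    (eventually_le_nhds (by norm_num)).filter_mono nhdsWithin_le_nhds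
  filter_upwards [this, self_mem_nhdsWithin] with z h1 h0
  have := h z h0 h1
  rw [hT] at this
  simpa using this

lemma tsum_eq_HH (z : ℝ) (h0 : 0 ≤ z) (h1 : z < 1) :
    ∑' n : ℕ, z^2^n / (1 + z^2^n) = HH z := by
  refine HasSum.tsum_eq ?_
  rw [hasSum_iff_tendsto_nat_of_nonneg (fun n => by positivity)]
  have h2 : Filter.Tendsto (fun m : ℕ => z^2^m) Filter.atTop (nhdsWithin 0 (Set.Ici 0)) := by
    rw [tendsto_nhdsWithin_iff]
    refine ⟨(tendsto_pow_atTop_nhds_zero_of_lt_one h0 h1).comp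
      (tendsto_pow_atTop_atTop_of_one_lt (by norm_num : 1 < 2)), ?_⟩
    exact Filter.Eventually.of_forall fun m => by simp; positivity
  have h3 := (HH_small.comp h2).const_sub (HH z)
  simp only [sub_zero] at h3
  refine h3.congr fun m => ?_
  simp only [Function.comp]
  linarith [HH_iter z h0 h1 m]

lemma TT_coeff (M n : ℕ) : (TT M).coeff n = if n < M then aCoef n else 0 := by
  simp [TT, Polynomial.coeff_X_pow]

/-- `T mod 2` -/
noncomputable def T2 (M : ℕ) : (ZMod 2)[X] := (TT M).map (Int.castRingHom (ZMod 2))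

lemma T2_coeff (M n : ℕ) : (T2 M).coeff n = if n < M then (aCoef n : ZMod 2) else 0 := by
  rw [T2, coeff_map, TT_coeff]; split_ifs <;> simp

lemma T2_sum_coeff (M n : ℕ) (h : n < M) : (T2 M ^ 2 + T2 M).coeff n = if n = 0 then 0 else 1 := by
  rw [← ZMod.expand_card, coeff_add, coeff_expand (by norm_num), T2_coeff, T2_coeff, if_pos h]
  rcases Nat.even_or_odd' n with ⟨k, rfl | rfl⟩
  · rcases Nat.eq_zero_or_pos k with rfl | hk
    · simp [aCoef_zero]
    · have h1 : 2 * k / 2 = k := by omega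
      have h2 : k < M := by omega
      have h3 : 2 * k ≠ 0 := by omega
      rw [if_pos (dvd_mul_right _ _), h1, if_pos h2, if_neg h3, aCoef_even k hk.ne']
      push_cast
      have : (2 : ZMod 2) = 0 := by decide
      have h5 : (-1 : ZMod 2) = 1 := by decide
      linear_combination (aCoef k : ZMod 2) * this + h5
  · rw [if_neg (by omega), if_neg (by omega), aCoef_odd]; simp

lemma T2_rel (M : ℕ) : X ^ M ∣ (1 + X) * (T2 M ^ 2 + T2 M) - X := by
  rw [X_pow_dvd_iff]
  intro d hd
  rw [coeff_sub, add_mul, one_mul, coeff_add, T2_sum_coeff M d hd]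
  rcases d with _ | d
  · simp
  · rw [coeff_X_mul, T2_sum_coeff M d (by omega), coeff_X]
    rcases d with _ | d
    · simp
    · simp; decide

lemma no_rat (n : ℕ) : ∀ P Q : (ZMod 2)[X], Q.natDegree < n → Q ^ 2 * X = (1 + X) * (P * (P + Q)) → Q = 0 := by
  induction n with
  | zero => intro P Q h; omega
  | succ n ih =>
    intro P Q hd h
    by_contra hQ
    have hX : (1 + X : (ZMod 2)[X]) = X - C 1 := by
      rw [sub_eq_add_neg, ← C_neg, show (-1 : ZMod 2) = 1 by decide, C_1, add_comm]
    have hp : Prime (1 + X : (ZMod 2)[X]) := by rw [hX]; exact prime_X_sub_C 1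
    have h1 : (1 + X : (ZMod 2)[X]) ∣ Q := by
      have : (1 + X : (ZMod 2)[X]) ∣ Q ^ 2 * X := ⟨_, h⟩
      rcases hp.dvd_or_dvd this with h2 | h2
      · exact hp.dvd_of_dvd_pow h2
      · exfalso
        rw [hX, dvd_iff_isRoot] at h2
        simp at h2
    obtain ⟨Q', rfl⟩ := h1
    have h3 : (1 + X) * Q' ^ 2 * X = P * (P + (1 + X) * Q') := by
      apply mul_left_cancel₀ hp.ne_zero
      linear_combination h
    have h4 : (1 + X : (ZMod 2)[X]) ∣ P := by
      apply hp.dvd_of_dvd_pow (n := 2)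
      exact ⟨Q' ^ 2 * X - P * Q', by linear_combination -h3⟩
    obtain ⟨P', rfl⟩ := h4
    have h5 : Q' ^ 2 * X = (1 + X) * (P' * (P' + Q')) := by
      apply mul_left_cancel₀ hp.ne_zero
      linear_combination h3
    have hQ' : Q' ≠ 0 := right_ne_zero_of_mul hQ
    refine hQ' (ih P' Q' ?_ h5)
    rw [natDegree_mul hp.ne_zero hQ', hX, natDegree_X_sub_C] at hd
    omega

lemma mod2_key (K : ℕ) (P Q : (ZMod 2)[X]) (hP : P.natDegree ≤ K) (hQ : Q.natDegree ≤ K)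
    (h : X ^ (2*K+2) ∣ Q * T2 (2*K+2) - P) : Q = 0 := by
  set T := T2 (2*K+2)
  have h2 : (2 : (ZMod 2)[X]) = 0 := by
    have : (2 : ZMod 2) = 0 := by decide
    rw [← C_ofNat, this, C_0]
  have hN : X ^ (2*K+2) ∣ Q^2 * X - (1+X) * (P * (P + Q)) := by
    have e : Q^2 * X - (1+X) * (P * (P + Q)) =
      (Q * T - P) * ((Q * T - P + Q) * (1 + X)) - ((1 + X) * (T^2 + T) - X) * Q^2 := by
      linear_combination (-(P^2) - P * T * Q * (-1)) * (1 + X) * h2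
    rw [e]
    exact dvd_sub (h.mul_right _) ((T2_rel _).mul_right _)
  have hz : Q^2 * X - (1+X) * (P * (P + Q)) = 0 := by
    by_contra hne
    obtain ⟨W, hW⟩ := hN
    have hd : (Q^2 * X - (1+X) * (P * (P + Q))).natDegree ≤ 2 * K + 1 := by
      have a1 : (Q^2 * X).natDegree ≤ 2*K+1 := by
        refine natDegree_mul_le.trans ?_
        have := natDegree_pow_le (p := Q) (n := 2)
        have := natDegree_X_le (R := ZMod 2)
        omega
      have a2 : ((1+X) * (P * (P + Q))).natDegree ≤ 2*K+1 := by
        refine natDegree_mul_le.trans ?_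
        have b1 := natDegree_mul_le (p := P) (q := P + Q)
        have b2 := natDegree_add_le_of_degree_le hP hQ
        have b3 : (1 + X : (ZMod 2)[X]).natDegree ≤ 1 := by compute_degree
        omega
      exact (natDegree_sub_le _ _).trans (max_le a1 a2)
    rw [hW] at hd hne
    have hW0 : W ≠ 0 := right_ne_zero_of_mul hne
    rw [natDegree_mul (pow_ne_zero _ X_ne_zero) hW0, natDegree_X_pow] at hd
    omega
  exact no_rat _ P Q (Nat.lt_succ_self _) (sub_eq_zero.1 hz)

lemma pade (K : ℕ) : ∃ P Q W : ℤ[X], P.natDegree ≤ K ∧ Q.natDegree ≤ K ∧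
    Q * TT (2*K+2) - P = X ^ (2*K+1) * W ∧ W.coeff 0 ≠ 0 := by
  set T := TT (2*K+2)
  -- the linear system
  obtain ⟨Q0, hQ0, hQ0d, hQ0c⟩ : ∃ Q0 : ℤ[X], Q0 ≠ 0 ∧ Q0.natDegree ≤ K ∧
      ∀ i < K, (Q0 * T).coeff (K + 1 + i) = 0 := by
    let pol : (Fin (K+1) → ℤ) →ₗ[ℤ] ℤ[X] :=
      { toFun := fun v => ∑ j : Fin (K+1), C (v j) * X ^ (j : ℕ)
        map_add' := fun v w => by simp [add_mul, Finset.sum_add_distrib]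
        map_smul' := fun c v => by simp [Finset.mul_sum, mul_assoc, Polynomial.smul_eq_C_mul] }
    let L : (Fin (K+1) → ℤ) →ₗ[ℤ] (Fin K → ℤ) :=
      LinearMap.pi fun i : Fin K => (lcoeff ℤ (K + 1 + i)) ∘ₗ (LinearMap.mulRight ℤ T) ∘ₗ pol
    have hL : ¬ Function.Injective L := by
      intro hinj
      have := LinearMap.finrank_le_finrank_of_injective hinj
      simp at this
    obtain ⟨v, hv, hv0⟩ : ∃ v, L v = 0 ∧ v ≠ 0 := by
      by_contra hcon
      push Not at hcon
      exact hL ((injective_iff_map_eq_zero L).2 hcon)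
    have hc : ∀ j : Fin (K+1), (pol v).coeff j = v j := by
      intro j
      simp only [pol, LinearMap.coe_mk, AddHom.coe_mk, finsetSum_coeff, coeff_C_mul, coeff_X_pow]
      rw [Finset.sum_eq_single j]
      · simp
      · intro i _ hij
        rw [if_neg (fun h => hij (Fin.ext h.symm)), mul_zero]
      · simp
    refine ⟨pol v, ?_, ?_, ?_⟩
    · intro h0
      apply hv0
      funext j
      rw [← hc j, h0]; simp
    · change (∑ j : Fin (K+1), C (v j) * X ^ (j : ℕ)).natDegree ≤ K
      refine natDegree_sum_le_of_forall_le _ _ (fun j _ => ?_)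
      exact (natDegree_C_mul_X_pow_le _ _).trans (by omega)
    · intro i hi
      have := congrFun hv ⟨i, hi⟩
      simpa [L] using this
  set Q := Q0.primPart
  have hcont : Q0.content ≠ 0 := by rwa [Ne, content_eq_zero_iff]
  have hQc : ∀ i < K, (Q * T).coeff (K + 1 + i) = 0 := by
    intro i hi
    have := hQ0c i hi
    rw [Q0.eq_C_content_mul_primPart, mul_assoc, coeff_C_mul] at this
    exact (mul_eq_zero.1 this).resolve_left hcont
  have hQd : Q.natDegree ≤ K := by rw [natDegree_primPart]; exact hQ0d
  set P : ℤ[X] := ∑ i ∈ Finset.range (K+1), C ((Q * T).coeff i) * X ^ i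
  have hPd : P.natDegree ≤ K := by
    refine natDegree_sum_le_of_forall_le _ _ (fun j hj => ?_)
    have := Finset.mem_range.1 hj
    exact (natDegree_C_mul_X_pow_le _ _).trans (by omega)
  have hPc : ∀ n, P.coeff n = if n < K+1 then (Q * T).coeff n else 0 := by
    intro n
    simp [P, Polynomial.coeff_X_pow]
  have hdvd : X ^ (2*K+1) ∣ Q * T - P := by
    rw [X_pow_dvd_iff]
    intro d hd
    rw [coeff_sub, hPc]
    split_ifs with h
    · simp
    · have := hQc (d - (K+1)) (by omega)
      rw [show K + 1 + (d - (K+1)) = d by omega] at this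
      rw [this]; simp
  obtain ⟨W, hW⟩ := hdvd
  refine ⟨P, Q, W, hPd, hQd, hW, fun hW0 => ?_⟩
  set φ := Int.castRingHom (ZMod 2)
  have hQ2 : Q.map φ = 0 := by
    refine mod2_key K (P.map φ) (Q.map φ) (natDegree_map_le.trans hPd) (natDegree_map_le.trans hQd) ?_
    obtain ⟨W', rfl⟩ := X_dvd_iff.2 hW0
    refine ⟨W'.map φ, ?_⟩
    have := congrArg (Polynomial.map φ) hW
    simp only [Polynomial.map_sub, Polynomial.map_mul, Polynomial.map_pow, Polynomial.map_X] at this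
    change Q.map φ * T.map φ - P.map φ = _
    rw [this]; ring
  have hdiv : C (2:ℤ) ∣ Q := by
    rw [C_dvd_iff_dvd_coeff]
    intro i
    have := congrArg (fun p => coeff p i) hQ2
    simp only [coeff_map, coeff_zero] at this
    exact (ZMod.intCast_zmod_eq_zero_iff_dvd _ 2).1 this
  have := Q0.isPrimitive_primPart 2 hdiv
  exact absurd this (by decide)

lemma poly_bdd (p : ℤ[X]) : ∃ C : ℝ, 0 < C ∧ ∀ z : ℝ, 0 ≤ z → z ≤ 1 → |aeval z p| ≤ C := by
  have hc : Continuous (fun z : ℝ => aeval z p) := p.continuous_aeval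
  obtain ⟨C, hC⟩ := (isCompact_Icc (a := (0:ℝ)) (b := 1)).exists_bound_of_continuousOn hc.continuousOn
  refine ⟨max C 1, by positivity, fun z h0 h1 => ?_⟩
  exact (hC z ⟨h0, h1⟩).trans (le_max_left _ _)

lemma pade_bound (K : ℕ) : ∃ P Q : ℤ[X], P.natDegree ≤ K ∧ Q.natDegree ≤ K ∧
    ∃ C δ : ℝ, 1 ≤ C ∧ 0 < δ ∧ ∀ z : ℝ, 0 < z → z ≤ δ → |aeval z Q| ≤ C ∧
      z ^ (2*K+1) / 2 ≤ |aeval z Q * HH z - aeval z P| ∧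
      |aeval z Q * HH z - aeval z P| ≤ C * z ^ (2*K+1) := by
  obtain ⟨P, Q, W, hP, hQ, hW, hc⟩ := pade K
  obtain ⟨CT, hCT, hT⟩ := HH_trunc (2*K+2)
  obtain ⟨CQ, hCQ, hQb⟩ := poly_bdd Q
  obtain ⟨V, hV⟩ : X ∣ W - C (W.coeff 0) := by rw [X_dvd_iff]; simp
  obtain ⟨CV, hCV, hVb⟩ := poly_bdd V
  set c := W.coeff 0
  have hc1 : (1:ℝ) ≤ |(c:ℝ)| := by exact_mod_cast Int.one_le_abs hc
  refine ⟨P, Q, hP, hQ, max CQ (|(c:ℝ)| + 1), min (1/2) (1 / (2 * (CV + CQ * CT))), ?_, by positivity, ?_⟩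
  · exact le_trans (by linarith) (le_max_right _ _)
  intro z hz0 hz
  have hz1 : z ≤ 1/2 := hz.trans (min_le_left _ _)
  have hz2 : z * (CV + CQ * CT) ≤ 1/2 := by
    have := hz.trans (min_le_right _ _)
    rw [le_div_iff₀ (by positivity)] at this
    linarith
  have hq := hQb z hz0.le (by linarith)
  have hv := hVb z hz0.le (by linarith)
  have ht := hT z hz0.le hz1
  have e1 := congrArg (aeval z) hW
  have e2 := congrArg (aeval z) hV
  simp only [map_sub, map_mul, map_pow, aeval_X, eq_intCast, map_intCast] at e1 e2
  have e3 : aeval z Q * HH z - aeval z P - c * z ^ (2*K+1) =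
      z ^ (2*K+1) * z * aeval z V + aeval z Q * (HH z - aeval z (TT (2*K+2))) := by
    linear_combination e1 + z ^ (2*K+1) * e2
  have hp : 0 < z ^ (2*K+1) := by positivity
  have h4 : |aeval z Q * HH z - aeval z P - c * z ^ (2*K+1)| ≤ z ^ (2*K+1) / 2 := by
    rw [e3]
    calc _ ≤ |z ^ (2*K+1) * z * aeval z V| + |aeval z Q * (HH z - aeval z (TT (2*K+2)))| := abs_add_le _ _
      _ = z ^ (2*K+1) * z * |aeval z V| + |aeval z Q| * |HH z - aeval z (TT (2*K+2))| := by
        rw [abs_mul, abs_mul (aeval z Q), abs_of_pos (by positivity : 0 < z ^ (2*K+1) * z)]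
      _ ≤ z ^ (2*K+1) * z * CV + CQ * (CT * z ^ (2*K+2)) := by gcongr
      _ = z ^ (2*K+1) * (z * (CV + CQ * CT)) := by ring
      _ ≤ z ^ (2*K+1) * (1/2) := by gcongr
      _ = _ := by ring
  have h5 : |(c:ℝ) * z ^ (2*K+1)| = |(c:ℝ)| * z ^ (2*K+1) := by rw [abs_mul, abs_of_pos hp]
  have h6 := abs_sub_abs_le_abs_sub (aeval z Q * HH z - aeval z P) (c * z ^ (2*K+1))
  have h7 := abs_sub_abs_le_abs_sub ((c:ℝ) * z ^ (2*K+1)) (aeval z Q * HH z - aeval z P)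
  rw [abs_sub_comm ((c:ℝ) * z ^ (2*K+1))] at h7
  refine ⟨hq.trans (le_max_left _ _), by nlinarith, ?_⟩
  refine le_trans ?_ (mul_le_mul_of_nonneg_right (le_max_right _ _) hp.le)
  nlinarith

lemma poly_int (p : ℤ[X]) (K : ℕ) (h : p.natDegree ≤ K) (B : ℕ) (hB : 0 < B) :
    ∃ n : ℤ, (B:ℝ) ^ K * aeval (1 / (B:ℝ)) p = n := by
  refine ⟨∑ i ∈ Finset.range (K+1), p.coeff i * (B:ℤ) ^ (K - i), ?_⟩
  rw [aeval_eq_sum_range' (Nat.lt_succ_of_le h), Finset.mul_sum]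
  push_cast
  refine Finset.sum_congr rfl fun i hi => ?_
  have hi' : i ≤ K := by have := Finset.mem_range.1 hi; omega
  have hB' : (B:ℝ) ≠ 0 := by positivity
  have : (B:ℝ)^K = B^(K-i) * B^i := by rw [← pow_add]; congr 1; omega
  rw [this, zsmul_eq_mul, one_div, inv_pow]
  field_simp

lemma denom (b : ℕ) (hb : 2 ≤ b) (m : ℕ) : ∃ (D : ℕ) (S : ℤ), D * (b - 1 : ℝ) + 1 = (b:ℝ)^2^m ∧
    (D:ℝ) * ∑ n ∈ Finset.range m, (1 / b : ℝ)^2^n / (1 + (1 / b : ℝ)^2^n) = S := by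
  induction m with
  | zero => exact ⟨1, 0, by simp, by simp⟩
  | succ m ih =>
    obtain ⟨D, S, h1, h2⟩ := ih
    refine ⟨D * (b^2^m + 1), S * (b^2^m + 1) + D, ?_, ?_⟩
    · push_cast
      rw [pow_succ 2 m, pow_mul, ← h1]; ring
    · rw [Finset.sum_range_succ]
      push_cast
      rw [← h2]
      have hb0 : (0:ℝ) < b := by positivity
      rw [one_div, inv_pow]
      have : (0:ℝ) < (b:ℝ)^2^m := by positivity
      generalize (b:ℝ)^2^m = B at *
      field_simp
      

lemma approx (b : ℕ) (hb : 2 ≤ b) (K : ℕ) : ∃ (C : ℝ) (m0 : ℕ), 1 ≤ C ∧ ∀ m ≥ m0, ∃ p q : ℤ,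
    |(q:ℝ)| ≤ C * ((b:ℝ)^2^m)^(K+1) ∧
    1 ≤ 2 * ((b:ℝ)^2^m)^(K+1) * |q * HH (1 / b) - p| ∧
    |q * HH (1 / b) - p| * ((b:ℝ)^2^m)^K ≤ C := by
  obtain ⟨P, Q, hP, hQ, C, δ, hC, hδ, h⟩ := pade_bound K
  have hb1 : (1:ℝ) < b := by exact_mod_cast hb
  have hb0 : (0:ℝ) < b := by linarith
  have hlim : Filter.Tendsto (fun m : ℕ => (1 / b : ℝ)^2^m) Filter.atTop (nhds 0) :=
    (tendsto_pow_atTop_nhds_zero_of_lt_one (by positivity) (by rw [div_lt_one hb0]; exact hb1)).comp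
      (tendsto_pow_atTop_atTop_of_one_lt (by norm_num : 1 < 2))
  obtain ⟨m0, hm0⟩ := Filter.eventually_atTop.1 (hlim.eventually (eventually_le_nhds hδ))
  refine ⟨C, m0, hC, fun m hm => ?_⟩
  have hz := hm0 m hm
  obtain ⟨D, S, hD, hS⟩ := denom b hb m
  have hit := HH_iter (1 / b) (by positivity) (by rw [div_lt_one hb0]; exact hb1) m
  obtain ⟨p1, hp1⟩ := poly_int P K hP (b^2^m) (by positivity)
  obtain ⟨q1, hq1⟩ := poly_int Q K hQ (b^2^m) (by positivity)
  push_cast at hp1 hq1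
  have hzB : (1 / b : ℝ)^2^m = 1 / (b:ℝ)^2^m := by rw [div_pow, one_pow]
  rw [hzB] at hz hit
  set B : ℝ := (b:ℝ)^2^m
  have hB1 : 1 ≤ B := one_le_pow₀ hb1.le
  have hB0 : 0 < B := by linarith
  obtain ⟨k1, k2, k3⟩ := h (1/B) (by positivity) hz
  have hD1 : (1:ℝ) ≤ D := by
    have : D ≠ 0 := by
      rintro rfl
      have : (1:ℝ) < B := one_lt_pow₀ hb1 (by positivity)
      simp at hD; linarith
    exact_mod_cast Nat.one_le_iff_ne_zero.2 this
  have hDB : (D:ℝ) ≤ B := by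
    have : (2:ℝ) ≤ b := by exact_mod_cast hb
    nlinarith
  have hq : ((D * q1 : ℤ) : ℝ) = D * B^K * aeval (1/B) Q := by push_cast; rw [← hq1]; ring
  have hE : ((D * q1 : ℤ) : ℝ) * HH (1 / b) - ((D * p1 + q1 * S : ℤ) : ℝ) =
      D * B^K * (aeval (1/B) Q * HH (1/B) - aeval (1/B) P) := by
    rw [hq, hit]; push_cast
    rw [← hp1, ← hq1, ← hS]; ring
  refine ⟨D * p1 + q1 * S, D * q1, ?_, ?_, ?_⟩
  · rw [hq, abs_mul, abs_of_pos (by positivity : 0 < D * B^K), pow_succ']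
    calc D * B^K * |aeval (1/B) Q| ≤ B * B^K * C := by gcongr
      _ = _ := by ring
  · rw [hE, abs_mul, abs_of_pos (by positivity : 0 < D * B^K)]
    calc (1:ℝ) = 2 * B^(K+1) * (1 * B^K * ((1/B)^(2*K+1)/2)) := by
          rw [div_pow, one_pow]; field_simp; ring
      _ ≤ _ := by gcongr
  · rw [hE, abs_mul, abs_of_pos (by positivity : 0 < D * B^K)]
    calc D * B^K * |aeval (1/B) Q * HH (1/B) - aeval (1/B) P| * B^K ≤
        B * B^K * (C * (1/B)^(2*K+1)) * B^K := by gcongr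
      _ = C := by rw [div_pow, one_pow]; field_simp; ring

lemma approx_unif (b : ℕ) (hb : 2 ≤ b) (L : ℕ) : ∃ (C : ℝ) (m0 : ℕ), 1 ≤ C ∧ ∀ K ≤ L, ∀ m ≥ m0, ∃ p q : ℤ,
    |(q:ℝ)| ≤ C * ((b:ℝ)^2^m)^(K+1) ∧
    1 ≤ 2 * ((b:ℝ)^2^m)^(K+1) * |q * HH (1 / b) - p| ∧
    |q * HH (1 / b) - p| * ((b:ℝ)^2^m)^K ≤ C := by
  choose C m0 hC h using approx b hb
  have hle : ∀ K ≤ L, C K ≤ ∑ k ∈ Finset.range (L+1), C k := fun K hK =>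
    Finset.single_le_sum (f := C) (fun i _ => by linarith [hC i]) (Finset.mem_range.2 (by omega))
  refine ⟨∑ k ∈ Finset.range (L+1), C k, ∑ k ∈ Finset.range (L+1), m0 k, (hC 0).trans (hle 0 (by omega)), ?_⟩
  intro K hK m hm
  have hm' : m ≥ m0 K := le_trans (Finset.single_le_sum (f := m0) (fun i _ => by omega)
    (Finset.mem_range.2 (by omega))) hm
  obtain ⟨p, q, h1, h2, h3⟩ := h K m hm'
  refine ⟨p, q, h1.trans ?_, h2, h3.trans (hle K hK)⟩
  have := hle K hK
  gcongr

lemma lower (b : ℕ) (hb : 2 ≤ b) (L : ℕ) (hL : 1 ≤ L) : ∃ C q0 : ℝ, 1 ≤ C ∧ ∀ (p : ℤ) (q : ℕ), 0 < q → q0 ≤ q →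
    1 ≤ 2 * C * (2 * C * (q:ℝ)) ^ (2 + 4 / (L:ℝ)) * |HH (1 / b) - p / q| := by
  obtain ⟨C, m0, hC, h⟩ := approx_unif b hb (2*L)
  have hb1 : (1:ℝ) < b := by exact_mod_cast hb
  have hb0 : (0:ℝ) < b := by linarith
  have hL0 : (0:ℝ) < L := by exact_mod_cast hL
  refine ⟨C, (b:ℝ) ^ ((L:ℝ) * 2^m0), hC, fun p q hq hq0 => ?_⟩
  have hq1 : (1:ℝ) ≤ q := by exact_mod_cast hq
  set Y : ℝ := 2 * C * q
  have hqY : (q:ℝ) ≤ Y := by simp only [Y]; nlinarith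
  have hY1 : 1 ≤ Y := hq1.trans hqY
  have hY0 : 0 < Y := by linarith
  set x := Real.logb b Y
  have hx : (b:ℝ)^x = Y := Real.rpow_logb hb0 hb1.ne' hY0
  have hxL : (L:ℝ) * 2^m0 ≤ x := by
    rw [← Real.rpow_le_rpow_left_iff hb1, hx]; exact hq0.trans hqY
  have h2m0 : (1:ℝ) ≤ 2^m0 := one_le_pow₀ (by norm_num)
  obtain ⟨m, hm1, hm2⟩ := exists_nat_pow_near (x := x / L) (y := (2:ℝ))
    (by rw [le_div_iff₀ hL0]; nlinarith) (by norm_num)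
  have hm : m0 ≤ m := by
    have : (2:ℝ)^m0 < 2^(m+1) := lt_of_le_of_lt (by rw [le_div_iff₀ hL0]; linarith) hm2
    have := (pow_lt_pow_iff_right₀ (by norm_num : (1:ℝ) < 2)).1 this
    omega
  have h2m : (0:ℝ) < 2^m := by positivity
  have hx0 : 0 < x := by nlinarith
  set K := ⌈x / 2^m⌉₊
  have hK : K ≤ 2 * L := by
    apply Nat.ceil_le.2
    rw [div_lt_iff₀ hL0, pow_succ] at hm2
    rw [div_le_iff₀ h2m]; push_cast; nlinarith
  have hK1 : x ≤ K * 2^m := by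
    have := Nat.le_ceil (x / 2^m)
    rwa [div_le_iff₀ h2m] at this
  have hK2 : K * 2^m ≤ x + 2^m := by
    have := (Nat.ceil_lt_add_one (by positivity : 0 ≤ x / 2^m)).le
    have h3 := mul_le_mul_of_nonneg_right this h2m.le
    rwa [add_mul, div_mul_cancel₀ _ h2m.ne', one_mul] at h3
  obtain ⟨p', q', k1, k2, k3⟩ := h K hK m hm
  have hBK : ∀ n : ℕ, ((b:ℝ)^2^m)^n = (b:ℝ)^((n:ℝ) * 2^m) := by
    intro n
    rw [← pow_mul, ← Real.rpow_natCast]; push_cast; congr 1; ring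
  have hYK : Y ≤ ((b:ℝ)^2^m)^K := by
    rw [hBK, ← hx]; exact (Real.rpow_le_rpow_left_iff hb1).2 hK1
  have hYK1 : ((b:ℝ)^2^m)^(K+1) ≤ Y ^ (1 + 2/(L:ℝ)) := by
    rw [hBK, ← hx, ← Real.rpow_mul hb0.le, Real.rpow_le_rpow_left_iff hb1]
    push_cast
    have : x * (1 + 2 / L) = x + 2 * (x / L) := by ring
    rw [this]; linarith
  set A := ((b:ℝ)^2^m)^(K+1)
  set G := Y ^ (1 + 2/(L:ℝ))
  have hGG : Y ^ (2 + 4/(L:ℝ)) = G * G := by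
    rw [← Real.rpow_add hY0]; congr 1; ring
  have hYG : Y ≤ G := by
    have := Real.rpow_le_rpow_of_exponent_le hY1 (by have : 0 < 2 / (L:ℝ) := by positivity
                                                     linarith : (1:ℝ) ≤ 1 + 2/(L:ℝ))
    simpa using this
  have hA0 : 0 < A := by positivity
  set α := HH (1 / b)
  have hqa : |α - p / q| * q = |q * α - p| := by
    have : (q:ℝ) * α - p = (α - p / q) * q := by field_simp
    rw [this, abs_mul, abs_of_pos (by linarith : (0:ℝ) < q)]
  rw [hGG]
  set d := |α - p / q|
  have hd0 : 0 ≤ d := abs_nonneg _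
  -- small
  have hsmall : q * |q' * α - p'| ≤ 1/2 := by
    have h3 : |q' * α - p'| * Y ≤ C := (mul_le_mul_of_nonneg_left hYK (abs_nonneg _)).trans k3
    have : C * (2 * (q * |q' * α - p'|)) ≤ C * 1 := by
      simp only [Y] at h3; linarith
    have := le_of_mul_le_mul_left this (by linarith)
    linarith
  by_cases hE : p * q' = p' * q
  · have hE' : (p:ℝ) * q' = p' * q := by exact_mod_cast hE
    have e : |(q':ℝ)| * (d * q) = q * |q' * α - p'| := by
      rw [hqa, ← abs_mul]
      nth_rewrite 2 [← abs_of_pos (by linarith : (0:ℝ) < q)]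
      rw [← abs_mul]; congr 1; linear_combination -hE'
    have e2 : |(q':ℝ)| * d = |q' * α - p'| := by
      apply mul_left_cancel₀ (by linarith : (q:ℝ) ≠ 0); linarith
    rw [← e2] at k2
    calc 1 ≤ 2 * A * (|(q':ℝ)| * d) := k2
      _ ≤ 2 * G * ((C * G) * d) := by
        have := k1.trans (mul_le_mul_of_nonneg_left hYK1 (by linarith))
        gcongr
      _ = _ := by ring
  · have h1 : (1:ℝ) ≤ |(p:ℝ) * q' - p' * q| := by
      exact_mod_cast Int.one_le_abs (sub_ne_zero.2 hE)
    have h2 : |(p:ℝ) * q' - p' * q| ≤ |(q':ℝ)| * (d * q) + q * |q' * α - p'| := by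
      have hqq : q * |q' * α - p'| = |q * (q' * α - p')| := by
        rw [abs_mul, abs_of_pos (by linarith : (0:ℝ) < q)]
      rw [hqa, ← abs_mul, hqq]
      have e : (p:ℝ) * q' - p' * q = -(q' * (q * α - p)) + q * (q' * α - p') := by ring
      rw [e]
      exact (abs_add_le _ _).trans (by rw [abs_neg])
    have h3 : 1 ≤ 2 * (|(q':ℝ)| * (d * q)) := by linarith
    calc 1 ≤ 2 * (|(q':ℝ)| * (d * q)) := h3
      _ ≤ 2 * ((C * G) * (d * G)) := by
        have := k1.trans (mul_le_mul_of_nonneg_left hYK1 (by linarith))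
        have := hqY.trans hYG
        gcongr
      _ = _ := by ring

lemma finite_of_gt (b : ℕ) (hb : 2 ≤ b) (μ : ℝ) (hμ : 2 < μ) :
    {pq : ℤ × ℕ | 0 < pq.2 ∧ |HH (1 / b) - (pq.1 : ℝ) / (pq.2 : ℝ)| < 1 / (pq.2 : ℝ) ^ μ}.Finite := by
  obtain ⟨L, hL⟩ := exists_nat_gt (max 1 (8 / (μ - 2)))
  have hL1 : (1:ℝ) < L := (le_max_left _ _).trans_lt hL
  have hL2 : 8 / (μ - 2) < L := (le_max_right _ _).trans_lt hL
  have hL0 : (0:ℝ) < L := by linarith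
  obtain ⟨C, q0, hC, h⟩ := lower b hb L (by exact_mod_cast hL1.le)
  set s : ℝ := 2 + 4 / (L:ℝ)
  have hs : s < μ := by
    rw [div_lt_iff₀ (by linarith)] at hL2
    have : 4 / (L:ℝ) < μ - 2 := by rw [div_lt_iff₀ hL0]; linarith
    simp only [s]; linarith
  set c : ℝ := 2 * C * (2 * C) ^ s
  have hlim : Filter.Tendsto (fun x : ℝ => x ^ (μ - s)) Filter.atTop Filter.atTop :=
    tendsto_rpow_atTop (by linarith)
  obtain ⟨N, hN⟩ := Filter.eventually_atTop.1 (hlim.eventually_ge_atTop c)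
  obtain ⟨M, hM⟩ := exists_nat_gt (max N q0)
  have hqM : ∀ (p : ℤ) (q : ℕ), 0 < q → |HH (1 / b) - (p : ℝ) / (q : ℝ)| < 1 / (q : ℝ) ^ μ → q < M := by
    intro p q hq hlt
    by_contra hcon
    have hMq : (M:ℝ) ≤ q := by exact_mod_cast not_lt.1 hcon
    have hq' : (0:ℝ) < q := by exact_mod_cast hq
    have h1 := h p q hq (by linarith [le_max_right N q0])
    have h2 := hN q (by linarith [le_max_left N q0])
    rw [Real.mul_rpow (by linarith) hq'.le] at h1
    have hqs : 0 < (q:ℝ)^s := by positivity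
    have h3 : (q:ℝ)^μ = q^(μ - s) * q^s := by rw [← Real.rpow_add hq']; congr 1; ring
    have hc0 : 0 < c := by positivity
    have h4 : 2 * C * ((2 * C)^s * (q:ℝ)^s) = c * q^s := by ring
    rw [h4] at h1
    have h5 : c * (q:ℝ)^s * |HH (1 / b) - (p : ℝ) / (q : ℝ)| < c * q^s * (1 / (q : ℝ) ^ μ) := by gcongr
    have h6 : c * (q:ℝ)^s * (1 / (q : ℝ) ^ μ) ≤ 1 := by
      rw [mul_one_div, div_le_one (by positivity), h3]; gcongr
    linarith
  set α := HH (1 / b)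
  obtain ⟨R, hR⟩ := exists_nat_gt ((|α| + 1) * M)
  refine ((Set.finite_Icc (-(R:ℤ)) R).prod (Set.finite_Iio M)).subset ?_
  rintro ⟨p, q⟩ ⟨hq, hlt⟩
  simp only at hq hlt
  have hqM' := hqM p q hq hlt
  have hq' : (1:ℝ) ≤ q := by exact_mod_cast hq
  have h1 : 1 / (q:ℝ)^μ ≤ 1 := by
    rw [div_le_one (by positivity)]; exact Real.one_le_rpow hq' (by linarith)
  have h2 : |(p:ℝ) / q| ≤ |α| + 1 := by
    have := abs_sub_abs_le_abs_sub ((p:ℝ)/q) α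
    rw [abs_sub_comm] at this
    linarith
  have h3 : |(p:ℝ)| ≤ R := by
    rw [abs_div, abs_of_pos (by linarith : (0:ℝ) < q), div_le_iff₀ (by linarith)] at h2
    have : (q:ℝ) ≤ M := by exact_mod_cast hqM'.le
    have : (|α| + 1) * q ≤ (|α| + 1) * M := by gcongr
    linarith
  have h4 : |p| ≤ (R:ℤ) := by exact_mod_cast h3
  exact ⟨abs_le.1 h4, hqM'⟩

lemma HH_irr (b : ℕ) (hb : 2 ≤ b) : Irrational (HH (1 / b)) := by
  rintro ⟨r, hr⟩
  refine (Set.infinite_of_injective_forall_mem (f := fun k : ℕ => ((k+1) * r.num, (k+1) * r.den)) ?_ ?_)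
    (finite_of_gt b hb 3 (by norm_num))
  · intro k l hkl
    simp only [Prod.mk.injEq] at hkl
    have := Nat.eq_of_mul_eq_mul_right r.den_pos hkl.2
    omega
  · intro k
    have hd : (0:ℝ) < r.den := by exact_mod_cast r.den_pos
    refine ⟨Nat.mul_pos (by omega) r.den_pos, ?_⟩
    have hk : (0:ℝ) < (k:ℝ) + 1 := by positivity
    have : HH (1 / b) - (((k+1) * r.num : ℤ) : ℝ) / (((k+1) * r.den : ℕ) : ℝ) = 0 := by
      rw [← hr, Rat.cast_def]; push_cast
      rw [mul_div_mul_left _ _ hk.ne', sub_self]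
    simp only
    rw [this, abs_zero]
    push_cast
    positivity

theorem irrationalityExponent_F (b : ℕ) (hb : 2 ≤ b) :
    irrationalityExponent
      (∑' n : ℕ, ((1 / b : ℝ) ^ 2 ^ n) / (1 + (1 / b : ℝ) ^ 2 ^ n)) = 2 := by
  have hb1 : (1:ℝ) < b := by exact_mod_cast hb
  have hb0 : (0:ℝ) < b := by linarith
  rw [tsum_eq_HH (1 / b) (by positivity) (by rw [div_lt_one hb0]; exact hb1)]
  unfold irrationalityExponent
  refine IsGreatest.csSup_eq ⟨?_, ?_⟩
  · have hinf := Real.infinite_rat_abs_sub_lt_one_div_den_sq_of_irrational (HH_irr b hb)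
    have hinj : Function.Injective (fun r : ℚ => (r.num, r.den)) := by
      intro r s h
      simp only [Prod.mk.injEq] at h
      exact Rat.ext h.1 h.2
    refine (hinf.image hinj.injOn).mono ?_
    rintro _ ⟨r, hr, rfl⟩
    refine ⟨r.den_pos, ?_⟩
    simp only [Set.mem_ofPred_eq] at hr ⊢
    rw [Rat.cast_def] at hr
    rw [Real.rpow_two]
    exact hr
  · intro μ hμ
    by_contra hcon
    exact hμ (finite_of_gt b hb μ (not_le.1 hcon))
end

section
/- The irrationality exponent of the sum of the reciprocals of the Fermat numbers, Σ_{n≥0} 1/(2^{2^n} + 1), equals 2. -/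
open Polynomial in
theorem fm_norm_ne_zero (P Q : (ZMod 2)[X]) (hQ : Q ≠ 0) :
    X * Q ^ 2 + (1 + X) * (P * (P + Q)) ≠ 0 := by
  intro h
  have h2 : ∀ A : (ZMod 2)[X], A + A = 0 := fun A => CharTwo.add_self_eq_zero A
  obtain ⟨S, hS⟩ : ∃ S, S = P + Q := ⟨_, rfl⟩
  have hQS : Q = P + S := by rw [hS, ← add_assoc, h2, zero_add]
  have h' : X * Q ^ 2 = (X + C 1) * (P * S) := by
    rw [← hS] at h
    have := h2 ((1 + X) * (P * S))
    rw [map_one]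
    linear_combination h - this
  have hne : X * Q ^ 2 ≠ 0 := mul_ne_zero X_ne_zero (pow_ne_zero _ hQ)
  have hPS : P * S ≠ 0 := by
    intro h0; rw [h0, mul_zero] at h'; exact hne h'
  have hP := left_ne_zero_of_mul hPS
  have hS0 := right_ne_zero_of_mul hPS
  have hd := congrArg natDegree h'
  rw [natDegree_mul X_ne_zero (pow_ne_zero _ hQ), natDegree_mul (X_add_C_ne_zero _) hPS,
    natDegree_mul hP hS0, natDegree_X_add_C, natDegree_X, natDegree_pow] at hd
  rcases lt_trichotomy P.natDegree S.natDegree with hlt | heq | hlt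
  · have := natDegree_add_eq_right_of_natDegree_lt hlt
    rw [← hQS] at this; omega
  · have l1 : ∀ A : (ZMod 2)[X], A ≠ 0 → A.leadingCoeff = 1 := by
      intro A hA
      have := leadingCoeff_ne_zero.mpr hA
      revert this; generalize A.leadingCoeff = c; revert c; decide
    have hdeg : degree (P + S) < degree P := by
      have h3 : P + S = P - S := by rw [CharTwo.sub_eq_add]
      rw [h3]
      apply degree_sub_lt_left
      · rw [degree_eq_natDegree hP, degree_eq_natDegree hS0, heq]
      · exact hP
      · rw [l1 P hP, l1 S hS0]
    rw [← hQS] at hdeg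
    have := natDegree_lt_natDegree hQ hdeg
    omega
  · have := natDegree_add_eq_left_of_natDegree_lt hlt
    rw [← hQS] at this; omega

def fm_c (j : ℕ) : ℤ := if j = 0 then 0 else 1 - (padicValNat 2 j : ℤ)

theorem fm_c_zero : fm_c 0 = 0 := by simp [fm_c]
theorem fm_c_odd (j : ℕ) : fm_c (2 * j + 1) = 1 := by
  have : padicValNat 2 (2 * j + 1) = 0 := padicValNat.eq_zero_of_not_dvd (by omega)
  simp [fm_c, this]
theorem fm_c_even (j : ℕ) (hj : j ≠ 0) : fm_c (2 * j) = fm_c j - 1 := by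
  have : padicValNat 2 (2 * j) = 1 + padicValNat 2 j := by
    rw [padicValNat.mul (by norm_num) hj, padicValNat.self (by norm_num)]
  simp [fm_c, this, hj]
theorem fm_c_abs (j : ℕ) : |fm_c j| ≤ j := by
  unfold fm_c
  split_ifs with h
  · simp
  · have h1 : padicValNat 2 j < j := by
      refine lt_of_le_of_lt (padicValNat_le_nat_log j) ?_
      exact Nat.log_lt_self 2 h
    rw [abs_le]; constructor <;> omega

open PowerSeries in
theorem fm_frob (f : PowerSeries (ZMod 2)) : f ^ 2 = expand 2 two_ne_zero f := by
  have := MvPowerSeries.map_frobenius_expand (σ := Unit) (R := ZMod 2) 2 (f := f) two_ne_zero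
  rw [ZMod.frobenius_zmod] at this
  rw [← this]
  simp
  rfl

open PowerSeries in
theorem fm_quad : (1 + X) * ((mk fun j => (fm_c j : ZMod 2)) ^ 2 + (mk fun j => (fm_c j : ZMod 2))) = X := by
  have h1 : ((mk fun j => (fm_c j : ZMod 2)) ^ 2 + (mk fun j => (fm_c j : ZMod 2)))
      = mk fun j => if j = 0 then 0 else 1 := by
    rw [fm_frob]
    ext n
    rw [map_add, coeff_mk, coeff_mk]
    rcases Nat.even_or_odd' n with ⟨m, rfl | rfl⟩
    · rw [coeff_expand_mul, coeff_mk]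
      by_cases hm : m = 0
      · subst hm; simp [fm_c_zero]
      · rw [fm_c_even m hm, if_neg (by omega)]
        push_cast
        have := CharTwo.add_self_eq_zero (fm_c m : ZMod 2)
        rw [CharTwo.sub_eq_add]
        linear_combination this
    · rw [coeff_expand_of_not_dvd _ _ _ (by omega), fm_c_odd]
      simp
  rw [h1]
  ext n
  rw [add_mul, one_mul, map_add]
  cases n with
  | zero => simp
  | succ n =>
    rw [coeff_succ_X_mul, coeff_mk, coeff_mk, coeff_X]
    rcases n with _ | n
    · simp
    · simp; rfl

theorem fm_lin (k : ℕ) (hk : 0 < k) : ∃ Q : Polynomial ℤ, Q ≠ 0 ∧ Q.natDegree ≤ k ∧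
    ∀ n, k < n → n ≤ 2 * k → PowerSeries.coeff n ((Q : PowerSeries ℤ) * PowerSeries.mk fm_c) = 0 := by
  let A : Matrix (Fin k) (Fin (k + 1)) ℤ := fun i j => fm_c (k + 1 + i - j)
  obtain ⟨t, ht0, hA, -⟩ := Int.Matrix.exists_ne_zero_int_vec_norm_le A (by simp) (by simpa)
  have hc : ∀ i : Fin (k + 1),
      (∑ j : Fin (k + 1), Polynomial.C (t j) * Polynomial.X ^ (j : ℕ)).coeff i = t i := by
    intro i
    rw [Polynomial.finsetSum_coeff]
    simp only [Polynomial.coeff_C_mul_X_pow]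
    rw [Finset.sum_eq_single i]
    · simp
    · intro b _ hb
      rw [if_neg]
      intro h; exact hb (Fin.ext h.symm)
    · simp
  refine ⟨∑ j : Fin (k + 1), Polynomial.C (t j) * Polynomial.X ^ (j : ℕ), ?_, ?_, ?_⟩
  · intro h0
    apply ht0
    ext i
    rw [← hc i, h0]; simp
  · apply Polynomial.natDegree_sum_le_of_forall_le
    intro i _
    exact (Polynomial.natDegree_C_mul_X_pow_le _ _).trans (by omega)
  · intro n hn1 hn2
    have h := congrFun hA ⟨n - (k + 1), by omega⟩
    have hcoe : ((∑ j : Fin (k + 1), Polynomial.C (t j) * Polynomial.X ^ (j : ℕ) : Polynomial ℤ) : PowerSeries ℤ)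
        = ∑ j : Fin (k + 1), PowerSeries.C (t j) * PowerSeries.X ^ (j : ℕ) := by
      rw [← Polynomial.coeToPowerSeries.ringHom_apply, map_sum]
      simp only [map_mul, map_pow, Polynomial.coeToPowerSeries.ringHom_apply, Polynomial.coe_C,
        Polynomial.coe_X]
    rw [hcoe, Finset.sum_mul, map_sum]
    rw [Matrix.mulVec, dotProduct] at h
    rw [Pi.zero_apply] at h
    rw [← h]
    apply Finset.sum_congr rfl
    intro j _
    rw [mul_assoc, PowerSeries.coeff_C_mul, PowerSeries.coeff_X_pow_mul', if_pos (by omega),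
      PowerSeries.coeff_mk, mul_comm]
    congr 2
    simp only
    omega

theorem fm_pade (k : ℕ) (hk : 0 < k) : ∃ Q P : Polynomial ℤ, Q.natDegree ≤ k ∧ P.natDegree ≤ k ∧
    (∀ n, n ≤ 2 * k → PowerSeries.coeff n ((Q : PowerSeries ℤ) * PowerSeries.mk fm_c) = P.coeff n) ∧
    PowerSeries.coeff (2 * k + 1) ((Q : PowerSeries ℤ) * PowerSeries.mk fm_c) ≠ 0 := by
  obtain ⟨Q0, hQ0, hdeg, hco⟩ := fm_lin k hk
  have hcont : Q0.content ≠ 0 := by rwa [Ne, Polynomial.content_eq_zero_iff]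
  obtain ⟨Q, hQdef⟩ : ∃ Q, Q = Q0.primPart := ⟨_, rfl⟩
  have hprim : Q.IsPrimitive := hQdef ▸ Q0.isPrimitive_primPart
  have hQdeg : Q.natDegree ≤ k := by rw [hQdef, Polynomial.natDegree_primPart]; exact hdeg
  have hQco : ∀ n, k < n → n ≤ 2 * k →
      PowerSeries.coeff n ((Q : PowerSeries ℤ) * PowerSeries.mk fm_c) = 0 := by
    intro n h1 h2
    have := hco n h1 h2
    rw [Q0.eq_C_content_mul_primPart, ← hQdef, Polynomial.coe_mul, Polynomial.coe_C, mul_assoc,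
      PowerSeries.coeff_C_mul] at this
    exact (mul_eq_zero.mp this).resolve_left hcont
  obtain ⟨P, hP⟩ : ∃ P, P = PowerSeries.trunc (2 * k + 1) ((Q : PowerSeries ℤ) * PowerSeries.mk fm_c) :=
    ⟨_, rfl⟩
  have hPco : ∀ n, n ≤ 2 * k →
      PowerSeries.coeff n ((Q : PowerSeries ℤ) * PowerSeries.mk fm_c) = P.coeff n := by
    intro n hn
    rw [hP, PowerSeries.coeff_trunc, if_pos (by omega)]
  have hPdeg : P.natDegree ≤ k := by
    rw [Polynomial.natDegree_le_iff_coeff_eq_zero]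
    intro n hn
    rw [hP, PowerSeries.coeff_trunc]
    split_ifs with h
    · exact hQco n (by omega) (by omega)
    · rfl
  refine ⟨Q, P, hQdeg, hPdeg, hPco, ?_⟩
  intro hzero
  let φ := Int.castRingHom (ZMod 2)
  obtain ⟨q, hq⟩ : ∃ q, q = Q.map φ := ⟨_, rfl⟩
  obtain ⟨p, hp⟩ : ∃ p, p = P.map φ := ⟨_, rfl⟩
  have hq0 : q ≠ 0 := by
    intro h
    have h2 : Polynomial.C (2 : ℤ) ∣ Q := by
      rw [Polynomial.C_dvd_iff_dvd_coeff]
      intro i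
      have := congrArg (fun f => Polynomial.coeff f i) (hq.symm.trans h)
      simp only [Polynomial.coeff_map, Polynomial.coeff_zero] at this
      exact (ZMod.intCast_zmod_eq_zero_iff_dvd _ 2).mp this
    have := hprim 2 h2
    rw [Int.isUnit_iff] at this
    omega
  have hdq : q.natDegree ≤ k := by rw [hq]; exact Polynomial.natDegree_map_le.trans hQdeg
  have hdp : p.natDegree ≤ k := by rw [hp]; exact Polynomial.natDegree_map_le.trans hPdeg
  apply fm_norm_ne_zero p q hq0
  obtain ⟨F, hF⟩ : ∃ F : PowerSeries (ZMod 2), F = PowerSeries.mk fun j => (fm_c j : ZMod 2) := ⟨_, rfl⟩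
  have hquad := fm_quad
  rw [← hF] at hquad
  have hR : (PowerSeries.X : PowerSeries (ZMod 2)) ^ (2 * k + 2) ∣ (q : PowerSeries (ZMod 2)) * F + (p : PowerSeries (ZMod 2)) := by
    rw [PowerSeries.X_pow_dvd_iff]
    intro n hn
    have hqF : (q : PowerSeries (ZMod 2)) * F = PowerSeries.map φ ((Q : PowerSeries ℤ) * PowerSeries.mk fm_c) := by
      rw [map_mul, hq, Polynomial.polynomial_map_coe, hF]
      congr 1
    have hpc : ∀ n, PowerSeries.coeff n (p : PowerSeries (ZMod 2)) = φ (P.coeff n) := by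
      intro n; rw [hp, Polynomial.coeff_coe, Polynomial.coeff_map]
    rw [map_add, hqF, hpc, PowerSeries.coeff_map]
    by_cases h : n ≤ 2 * k
    · rw [hPco n h]; exact CharTwo.add_self_eq_zero _
    · have : n = 2 * k + 1 := by omega
      rw [this, hzero, Polynomial.coeff_eq_zero_of_natDegree_lt (by omega)]
      simp
  have hT : ((Polynomial.X * q ^ 2 + (1 + Polynomial.X) * (p * (p + q)) : Polynomial (ZMod 2)) :
      PowerSeries (ZMod 2)) = ((q : PowerSeries (ZMod 2)) * F + (p : PowerSeries (ZMod 2))) *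
        ((1 + PowerSeries.X) * ((q : PowerSeries (ZMod 2)) * F + (p : PowerSeries (ZMod 2)) + (q : PowerSeries (ZMod 2)))) := by
    push_cast
    have h20 : ∀ A : PowerSeries (ZMod 2), A + A = 0 := by
      intro A; ext n; rw [map_add]; exact CharTwo.add_self_eq_zero _
    have h2 := h20 ((1 + PowerSeries.X) * (q : PowerSeries (ZMod 2)) * F * (p : PowerSeries (ZMod 2)))
    linear_combination (-(q : PowerSeries (ZMod 2)) ^ 2) * hquad - h2
  have hdvd := hR.mul_right ((1 + PowerSeries.X : PowerSeries (ZMod 2)) * ((q : PowerSeries (ZMod 2)) * F + (p : PowerSeries (ZMod 2)) + (q : PowerSeries (ZMod 2))))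
  rw [← hT, PowerSeries.X_pow_dvd_iff] at hdvd
  ext n
  rw [Polynomial.coeff_zero]
  by_cases hn : n < 2 * k + 2
  · have := hdvd n hn
    rwa [Polynomial.coeff_coe] at this
  · apply Polynomial.coeff_eq_zero_of_natDegree_lt
    refine lt_of_le_of_lt ?_ (not_lt.mp hn)
    have hX : (Polynomial.X : Polynomial (ZMod 2)).natDegree ≤ 1 := Polynomial.natDegree_X_le
    have h1X : (1 + Polynomial.X : Polynomial (ZMod 2)).natDegree ≤ 1 :=
      Polynomial.natDegree_add_le_of_degree_le (by simp) hX
    have e1 : 2 * k + 1 = 1 + 2 * k := by ring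
    have e2 : 2 * k + 1 = 1 + (k + k) := by ring
    apply Polynomial.natDegree_add_le_of_degree_le
    · rw [e1]
      exact Polynomial.natDegree_mul_le_of_le hX (Polynomial.natDegree_pow_le_of_le 2 hdq)
    · rw [e2]
      exact Polynomial.natDegree_mul_le_of_le h1X (Polynomial.natDegree_mul_le_of_le hdp
        (Polynomial.natDegree_add_le_of_degree_le hdp hdq))

noncomputable def fm_f (z : ℝ) : ℝ := ∑' j : ℕ, (fm_c j : ℝ) * z ^ j

theorem fm_c_absR (j : ℕ) : |(fm_c j : ℝ)| ≤ j := by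
  have := fm_c_abs j
  exact_mod_cast this

theorem fm_summable_abs (z : ℝ) (h0 : 0 ≤ z) (h1 : z < 1) :
    Summable fun j : ℕ => |(fm_c j : ℝ)| * z ^ j := by
  have h := summable_pow_mul_geometric_of_norm_lt_one (R := ℝ) 1 (r := z)
    (by rw [Real.norm_eq_abs, abs_of_nonneg h0]; exact h1)
  refine Summable.of_nonneg_of_le (fun j => by positivity) (fun j => ?_) h
  rw [pow_one]
  exact mul_le_mul_of_nonneg_right (fm_c_absR j) (by positivity)

theorem fm_summable (z : ℝ) (h0 : 0 ≤ z) (h1 : z < 1) :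
    Summable fun j : ℕ => (fm_c j : ℝ) * z ^ j := by
  apply Summable.of_abs
  refine (fm_summable_abs z h0 h1).congr fun j => ?_
  rw [abs_mul, abs_of_nonneg (pow_nonneg h0 j)]

theorem fm_feq (z : ℝ) (h0 : 0 ≤ z) (h1 : z < 1) : fm_f z = z / (1 + z) + fm_f (z ^ 2) := by
  have hw0 : 0 ≤ z ^ 2 := by positivity
  have hw1 : z ^ 2 < 1 := by nlinarith
  have a1 : HasSum (fun j : ℕ => (fm_c j : ℝ) * (z ^ 2) ^ j) (fm_f (z ^ 2)) :=
    (fm_summable _ hw0 hw1).hasSum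
  have a2 := hasSum_geometric_of_lt_one hw0 hw1
  have a3 : HasSum (fun j : ℕ => if j = 0 then (1 : ℝ) else 0) 1 := hasSum_ite_eq 0 1
  have ev : HasSum (fun j : ℕ => (fm_c (2 * j) : ℝ) * z ^ (2 * j))
      (fm_f (z ^ 2) - (1 - z ^ 2)⁻¹ + 1) := by
    have := (a1.sub a2).add a3
    refine this.congr_fun ?_
    intro j
    by_cases hj : j = 0
    · subst hj; simp [fm_c_zero]
    · rw [fm_c_even j hj, if_neg hj, pow_mul]; push_cast; ring
  have od : HasSum (fun j : ℕ => (fm_c (2 * j + 1) : ℝ) * z ^ (2 * j + 1))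
      (z * (1 - z ^ 2)⁻¹) := by
    refine (a2.mul_left z).congr_fun ?_
    intro j
    rw [fm_c_odd, pow_succ, pow_mul]; push_cast; ring
  have := (HasSum.even_add_odd (f := fun j : ℕ => (fm_c j : ℝ) * z ^ j) ev od).tsum_eq
  rw [fm_f, this]
  have e1 : 1 - z ^ 2 ≠ 0 := by linarith
  have e2 : 1 + z ≠ 0 := by linarith
  field_simp
  ring

theorem fm_rem (N : ℕ) : ∃ C : ℝ, 0 ≤ C ∧ ∀ z : ℝ, 0 ≤ z → z ≤ 1 / 2 →
    |fm_f z - ∑ j ∈ Finset.range N, (fm_c j : ℝ) * z ^ j| ≤ C * z ^ N := by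
  have hs : Summable fun i : ℕ => |(fm_c (i + N) : ℝ)| * (1 / 2 : ℝ) ^ i := by
    have h := (summable_nat_add_iff N).mpr (fm_summable_abs (1 / 2) (by norm_num) (by norm_num))
    refine (h.mul_right ((2 : ℝ) ^ N)).congr fun i => ?_
    rw [pow_add, mul_assoc, mul_assoc, ← mul_pow]; norm_num
  refine ⟨∑' i : ℕ, |(fm_c (i + N) : ℝ)| * (1 / 2 : ℝ) ^ i, tsum_nonneg fun i => by positivity, ?_⟩
  intro z h0 h1
  have hz := fm_summable z h0 (by linarith)
  have e := hz.sum_add_tsum_nat_add N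
  have e' : fm_f z - ∑ j ∈ Finset.range N, (fm_c j : ℝ) * z ^ j
      = ∑' i : ℕ, (fm_c (i + N) : ℝ) * z ^ (i + N) := by
    rw [fm_f, ← e]; ring
  rw [e', ← Real.norm_eq_abs]
  apply tsum_of_norm_bounded (hs.hasSum.mul_right (z ^ N))
  intro i
  rw [Real.norm_eq_abs, abs_mul, abs_of_nonneg (pow_nonneg h0 _), pow_add, ← mul_assoc]
  gcongr

theorem fm_iter (m : ℕ) : fm_f (1 / 2) = ∑ n ∈ Finset.range m, 1 / ((2 : ℝ) ^ 2 ^ n + 1)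
    + fm_f (1 / 2 ^ 2 ^ m) := by
  induction m with
  | zero => simp
  | succ m ih =>
    have hX : (1 : ℝ) < 2 ^ 2 ^ m := one_lt_pow₀ (by norm_num) (by positivity)
    have := fm_feq (1 / 2 ^ 2 ^ m) (by positivity) (by rw [div_lt_one (by positivity)]; exact hX)
    rw [Finset.sum_range_succ, ih, this, pow_succ 2 m, pow_mul, ← add_assoc]
    congr 1
    · congr 1
      field_simp
    · rw [div_pow, one_pow]

theorem fm_tendsto : Filter.Tendsto (fun m : ℕ => (1 : ℝ) / 2 ^ 2 ^ m) Filter.atTop (nhds 0) := by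
  have h1 : Filter.Tendsto (fun n : ℕ => (1 / 2 : ℝ) ^ n) Filter.atTop (nhds 0) :=
    tendsto_pow_atTop_nhds_zero_of_lt_one (by norm_num) (by norm_num)
  have h2 : Filter.Tendsto (fun m : ℕ => 2 ^ m) Filter.atTop (Filter.atTop : Filter ℕ) :=
    tendsto_pow_atTop_atTop_of_one_lt (by norm_num)
  refine (h1.comp h2).congr fun m => ?_
  simp

theorem fm_le_half (m : ℕ) : (1 : ℝ) / 2 ^ 2 ^ m ≤ 1 / 2 := by
  apply one_div_le_one_div_of_le (by norm_num)
  exact le_self_pow₀ (by norm_num) (by positivity)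

theorem fm_alpha : ∑' n : ℕ, 1 / ((2 : ℝ) ^ 2 ^ n + 1) = fm_f (1 / 2) := by
  apply HasSum.tsum_eq
  rw [hasSum_iff_tendsto_nat_of_nonneg (fun n => by positivity)]
  obtain ⟨C, hC, h⟩ := fm_rem 1
  have h0 : Filter.Tendsto (fun m : ℕ => fm_f (1 / 2 ^ 2 ^ m)) Filter.atTop (nhds 0) := by
    apply squeeze_zero_norm (a := fun m : ℕ => C * (1 / 2 ^ 2 ^ m))
    · intro m
      have := h (1 / 2 ^ 2 ^ m) (by positivity) (fm_le_half m)
      simpa [fm_c_zero] using this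
    · simpa using fm_tendsto.const_mul C
  have := (tendsto_const_nhds (x := fm_f (1 / 2))).sub h0
  rw [sub_zero] at this
  refine this.congr fun m => ?_
  rw [fm_iter m]; ring

theorem fm_bdd (W : Polynomial ℤ) : ∃ M : ℝ, 0 ≤ M ∧ ∀ z : ℝ, 0 ≤ z → z ≤ 1 / 2 →
    |Polynomial.aeval z W| ≤ M := by
  obtain ⟨M, hM⟩ := (isCompact_Icc (a := (0 : ℝ)) (b := 1 / 2)).exists_bound_of_continuousOn
    (f := fun z => Polynomial.aeval z W) (Polynomial.continuous_aeval W).continuousOn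
  exact ⟨|M|, abs_nonneg _, fun z h0 h1 => (hM z ⟨h0, h1⟩).trans (le_abs_self M)⟩

theorem fm_local (k : ℕ) (hk : 0 < k) : ∃ Q P : Polynomial ℤ, Q.natDegree ≤ k ∧ P.natDegree ≤ k ∧
    ∃ C z0 : ℝ, 0 < C ∧ 0 < z0 ∧ ∀ z : ℝ, 0 < z → z ≤ 1 / 2 → z ≤ z0 →
      z ^ (2 * k + 1) / 2 ≤ |Polynomial.aeval z Q * fm_f z - Polynomial.aeval z P| ∧
      |Polynomial.aeval z Q * fm_f z - Polynomial.aeval z P| ≤ C * z ^ (2 * k + 1) ∧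
      |Polynomial.aeval z Q| ≤ C := by
  obtain ⟨Q, P, hQ, hP, hco, hne⟩ := fm_pade k hk
  refine ⟨Q, P, hQ, hP, ?_⟩
  obtain ⟨c, hc⟩ : ∃ c, c = PowerSeries.coeff (2 * k + 1)
    ((Q : PowerSeries ℤ) * PowerSeries.mk fm_c) := ⟨_, rfl⟩
  rw [← hc] at hne
  obtain ⟨t, ht⟩ : ∃ t, t = PowerSeries.trunc (2 * k + 2) (PowerSeries.mk fm_c) := ⟨_, rfl⟩
  have hdvd : Polynomial.X ^ (2 * k + 2) ∣
      Q * t - P - Polynomial.C c * Polynomial.X ^ (2 * k + 1) := by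
    rw [Polynomial.X_pow_dvd_iff]
    intro n hn
    have h1 : (Q * t).coeff n = PowerSeries.coeff n ((Q : PowerSeries ℤ) * PowerSeries.mk fm_c) := by
      rw [Polynomial.coeff_mul, PowerSeries.coeff_mul]
      apply Finset.sum_congr rfl
      intro x hx
      rw [Finset.HasAntidiagonal.mem_antidiagonal] at hx
      rw [ht, PowerSeries.coeff_trunc, if_pos (by omega), Polynomial.coeff_coe]
    rw [Polynomial.coeff_sub, Polynomial.coeff_sub, h1, Polynomial.coeff_C_mul_X_pow]
    by_cases h : n ≤ 2 * k
    · rw [hco n h, if_neg (by omega)]; ring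
    · have h2 : n = 2 * k + 1 := by omega
      subst h2
      rw [if_pos rfl, ← hc, Polynomial.coeff_eq_zero_of_natDegree_lt (p := P) (by omega)]; ring
  obtain ⟨W, hW⟩ := hdvd
  obtain ⟨MW, hMW0, hMW⟩ := fm_bdd W
  obtain ⟨MQ, hMQ0, hMQ⟩ := fm_bdd Q
  obtain ⟨D, hD0, hD⟩ := fm_rem (2 * k + 2)
  obtain ⟨E, hE⟩ : ∃ E, E = MW + MQ * D + 1 := ⟨_, rfl⟩
  have hE0 : 0 < E := by rw [hE]; positivity
  have hc1 : (1 : ℝ) ≤ |(c : ℝ)| := by exact_mod_cast Int.one_le_abs hne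
  refine ⟨|(c : ℝ)| + 1 + MQ, 1 / (2 * E), by positivity, by positivity, ?_⟩
  intro z h0 h1 h2
  have ht' : Polynomial.aeval z t = ∑ j ∈ Finset.range (2 * k + 2), (fm_c j : ℝ) * z ^ j := by
    rw [ht, Polynomial.aeval_def, PowerSeries.eval₂_trunc_eq_sum_range]
    simp
  have hW' := congrArg (Polynomial.aeval z) hW
  simp only [map_sub, map_mul, map_pow, Polynomial.aeval_X, Polynomial.aeval_C] at hW'
  have hr := hD z h0.le h1
  rw [← ht'] at hr
  have hcc : (algebraMap ℤ ℝ) c = (c : ℝ) := by simp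
  rw [hcc] at hW'
  have key : |Polynomial.aeval z Q * fm_f z - Polynomial.aeval z P - c * z ^ (2 * k + 1)|
      ≤ E * z ^ (2 * k + 2) := by
    have e : Polynomial.aeval z Q * fm_f z - Polynomial.aeval z P - c * z ^ (2 * k + 1)
      = z ^ (2 * k + 2) * Polynomial.aeval z W
        + Polynomial.aeval z Q * (fm_f z - Polynomial.aeval z t) := by
      rw [← hW']; ring
    rw [e]
    refine (abs_add_le _ _).trans ?_
    rw [abs_mul, abs_mul, abs_of_pos (pow_pos h0 _)]
    have i1 : |Polynomial.aeval z Q| * |fm_f z - Polynomial.aeval z t| ≤ MQ * (D * z ^ (2 * k + 2)) :=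
      mul_le_mul (hMQ z h0.le h1) hr (abs_nonneg _) hMQ0
    have i2 : z ^ (2 * k + 2) * |Polynomial.aeval z W| ≤ z ^ (2 * k + 2) * MW :=
      mul_le_mul_of_nonneg_left (hMW z h0.le h1) (by positivity)
    have i3 : 0 < z ^ (2 * k + 2) := by positivity
    rw [hE]
    linarith
  have hz : 0 < z ^ (2 * k + 1) := by positivity
  have key2 : E * z ^ (2 * k + 2) ≤ z ^ (2 * k + 1) / 2 := by
    have : E * z ≤ 1 / 2 := by
      rw [le_div_iff₀ (by positivity)] at h2
      linarith
    calc E * z ^ (2 * k + 2) = (E * z) * z ^ (2 * k + 1) := by ring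
      _ ≤ 1 / 2 * z ^ (2 * k + 1) := mul_le_mul_of_nonneg_right this hz.le
      _ = _ := by ring
  have hcz : |(c : ℝ) * z ^ (2 * k + 1)| = |(c : ℝ)| * z ^ (2 * k + 1) := by
    rw [abs_mul, abs_of_pos hz]
  have t1 := abs_sub_abs_le_abs_sub ((c : ℝ) * z ^ (2 * k + 1))
    (Polynomial.aeval z Q * fm_f z - Polynomial.aeval z P)
  rw [abs_sub_comm ((c : ℝ) * z ^ (2 * k + 1))] at t1
  have t2 := abs_sub_abs_le_abs_sub (Polynomial.aeval z Q * fm_f z - Polynomial.aeval z P)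
    ((c : ℝ) * z ^ (2 * k + 1))
  have t3 : 1 * z ^ (2 * k + 1) ≤ |(c : ℝ)| * z ^ (2 * k + 1) :=
    mul_le_mul_of_nonneg_right hc1 hz.le
  have t4 : 0 ≤ MQ * z ^ (2 * k + 1) := by positivity
  refine ⟨by linarith, by linarith, ?_⟩
  have := hMQ z h0.le h1
  linarith [abs_nonneg (c : ℝ)]

theorem fm_int (Q : Polynomial ℤ) (k : ℕ) (hQ : Q.natDegree ≤ k) (X : ℕ) (hX : 0 < X) :
    ∃ a : ℤ, (a : ℝ) = (X : ℝ) ^ k * Polynomial.aeval (1 / (X : ℝ)) Q := by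
  refine ⟨∑ i ∈ Finset.range (k + 1), Q.coeff i * (X : ℤ) ^ (k - i), ?_⟩
  rw [Polynomial.aeval_eq_sum_range' (n := k + 1) (by omega), Finset.mul_sum]
  push_cast
  apply Finset.sum_congr rfl
  intro i hi
  rw [Finset.mem_range] at hi
  have hX' : (X : ℝ) ≠ 0 := by positivity
  have : (X : ℝ) ^ k = X ^ (k - i) * X ^ i := by rw [← pow_add]; congr 1; omega
  rw [this, zsmul_eq_mul, div_pow, one_pow]
  field_simp

theorem fm_den (m : ℕ) : ∃ a : ℤ, (a : ℝ) = ((2 : ℝ) ^ 2 ^ m - 1) *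
    ∑ n ∈ Finset.range m, 1 / ((2 : ℝ) ^ 2 ^ n + 1) := by
  induction m with
  | zero => exact ⟨0, by simp⟩
  | succ m ih =>
    obtain ⟨a, ha⟩ := ih
    refine ⟨a * (2 ^ 2 ^ m + 1) + (2 ^ 2 ^ m - 1), ?_⟩
    push_cast
    rw [ha, Finset.sum_range_succ, pow_succ 2 m, pow_mul]
    have : (2 : ℝ) ^ 2 ^ m + 1 ≠ 0 := by positivity
    field_simp
    ring

theorem fm_approx (k : ℕ) (hk : 0 < k) : ∃ C : ℝ, ∃ m0 : ℕ, 0 < C ∧ ∀ m, m0 ≤ m → ∃ q p : ℤ,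
    |(q : ℝ)| ≤ C * ((2 : ℝ) ^ 2 ^ m) ^ (k + 1) ∧
    1 / (4 * ((2 : ℝ) ^ 2 ^ m) ^ k) ≤ |q * fm_f (1 / 2) - p| ∧
    |q * fm_f (1 / 2) - p| ≤ C / ((2 : ℝ) ^ 2 ^ m) ^ k := by
  obtain ⟨Q, P, hQ, hP, C, z0, hC, hz0, h⟩ := fm_local k hk
  obtain ⟨m0, hm0⟩ := Filter.eventually_atTop.mp (fm_tendsto.eventually (ge_mem_nhds hz0))
  refine ⟨C, m0, hC, ?_⟩
  intro m hm
  obtain ⟨h1, h2, h3⟩ := h (1 / 2 ^ 2 ^ m) (by positivity) (fm_le_half m) (hm0 m hm)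
  obtain ⟨a, ha⟩ := fm_int Q k hQ (2 ^ 2 ^ m) (by positivity)
  obtain ⟨b, hb⟩ := fm_int P k hP (2 ^ 2 ^ m) (by positivity)
  obtain ⟨N, hN⟩ := fm_den m
  push_cast at ha hb
  have hX2 : (2 : ℝ) ≤ 2 ^ 2 ^ m := le_self_pow₀ (by norm_num) (by positivity)
  have hit := fm_iter m
  refine ⟨a * (2 ^ 2 ^ m - 1), b * (2 ^ 2 ^ m - 1) + a * N, ?_⟩
  push_cast
  rw [hN]
  have e : (a : ℝ) * (2 ^ 2 ^ m - 1) * fm_f (1 / 2) - (b * (2 ^ 2 ^ m - 1) +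
      a * ((2 ^ 2 ^ m - 1) * ∑ n ∈ Finset.range m, 1 / ((2 : ℝ) ^ 2 ^ n + 1)))
      = (2 ^ 2 ^ m - 1) * (2 ^ 2 ^ m) ^ k * (Polynomial.aeval (1 / 2 ^ 2 ^ m : ℝ) Q
        * fm_f (1 / 2 ^ 2 ^ m) - Polynomial.aeval (1 / 2 ^ 2 ^ m : ℝ) P) := by
    rw [hit, ha, hb]; ring
  rw [e, ha]
  generalize (2 : ℝ) ^ 2 ^ m = X at *
  have hX0 : 0 < X := by linarith
  have hXk : 0 < X ^ k := by positivity
  have hX1 : 0 < X - 1 := by linarith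
  generalize Polynomial.aeval (1 / X) Q * fm_f (1 / X) - Polynomial.aeval (1 / X) P = R at *
  generalize Polynomial.aeval (1 / X) Q = Y at *
  rw [abs_mul, abs_mul, abs_mul, abs_mul, abs_of_pos hXk, abs_of_pos hX1]
  have ez : (1 / X) ^ (2 * k + 1) = 1 / (X ^ k * X ^ k * X) := by
    rw [div_pow, one_pow]; congr 1; ring
  rw [ez] at h1 h2
  refine ⟨?_, ?_, ?_⟩
  · calc X ^ k * |Y| * (X - 1) ≤ X ^ k * C * X := by gcongr; linarith
      _ = _ := by ring
  · calc 1 / (4 * X ^ k) = (X / 2) * X ^ k * (1 / (X ^ k * X ^ k * X) / 2) := by field_simp; norm_num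
      _ ≤ (X - 1) * X ^ k * |R| := by gcongr; linarith
  · calc (X - 1) * X ^ k * |R| ≤ X * X ^ k * (C * (1 / (X ^ k * X ^ k * X))) := by gcongr; linarith
      _ = _ := by field_simp

theorem fm_lower (K : ℕ) (hK : 0 < K) : ∃ c : ℝ, ∃ q0 : ℕ, 0 < c ∧ ∀ q : ℕ, q0 ≤ q → 0 < q → ∀ p : ℤ,
    c / (q : ℝ) ^ (2 + 3 / K : ℝ) ≤ |fm_f (1 / 2) - p / q| := by
  choose C m0 hC h using fun k => fm_approx (k + 1) (Nat.succ_pos k)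
  obtain ⟨D, hD⟩ : ∃ D, D = 1 + ∑ j ∈ Finset.range (2 * K), C j := ⟨_, rfl⟩
  have hsum : 0 ≤ ∑ j ∈ Finset.range (2 * K), C j := Finset.sum_nonneg fun j _ => (hC j).le
  have hD1 : 1 ≤ D := by rw [hD]; linarith
  have hCD : ∀ j, j < 2 * K → C j ≤ D := by
    intro j hj
    have := Finset.single_le_sum (f := C) (fun j _ => (hC j).le) (Finset.mem_range.mpr hj)
    rw [hD]; linarith
  obtain ⟨n0, hn0⟩ : ∃ n, n = ∑ j ∈ Finset.range (2 * K), m0 j := ⟨_, rfl⟩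
  have hmn : ∀ j, j < 2 * K → m0 j ≤ n0 := by
    intro j hj
    rw [hn0]
    exact Finset.single_le_sum (f := m0) (fun j _ => Nat.zero_le _) (Finset.mem_range.mpr hj)
  refine ⟨1 / (4 * D * (2 * D) ^ (2 + 3 / K : ℝ)), (2 ^ 2 ^ n0) ^ K, by positivity, ?_⟩
  intro q hq hq0 p
  have hqR : (1 : ℝ) ≤ q := by exact_mod_cast hq0
  obtain ⟨T, hT⟩ : ∃ T, T = 2 * D * q := ⟨_, rfl⟩
  have hT1 : 1 ≤ T := by rw [hT]; nlinarith
  have hT0 : 0 < T := by linarith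
  have hqT : (q : ℝ) ≤ T := by rw [hT]; nlinarith
  have hX1 : ∀ m : ℕ, (1 : ℝ) < 2 ^ 2 ^ m := fun m => one_lt_pow₀ (by norm_num) (by positivity)
  -- choose m
  have hex : ∃ m : ℕ, T < ((2 : ℝ) ^ 2 ^ m) ^ K := by
    obtain ⟨m, hm⟩ := pow_unbounded_of_one_lt T (one_lt_two)
    refine ⟨m, hm.trans_le ?_⟩
    rw [← pow_mul]
    apply pow_le_pow_right₀ (by norm_num)
    exact (Nat.lt_two_pow_self).le.trans (Nat.le_mul_of_pos_right _ hK)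
  obtain ⟨m, hm1, hm2, hm3⟩ : ∃ m : ℕ, n0 ≤ m ∧ ((2 : ℝ) ^ 2 ^ m) ^ K ≤ T ∧
      T < ((2 : ℝ) ^ 2 ^ m) ^ (2 * K) := by
    classical
    have hlt : n0 < Nat.find hex := by
      rw [Nat.lt_find_iff]
      intro i hi
      rw [not_lt]
      refine le_trans ?_ hqT
      refine le_trans ?_ (by exact_mod_cast hq : ((((2 ^ 2 ^ n0) ^ K : ℕ)) : ℝ) ≤ q)
      push_cast
      gcongr
      norm_num
      norm_num
    obtain ⟨m, hm⟩ := Nat.exists_eq_succ_of_ne_zero (show Nat.find hex ≠ 0 by omega)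
    refine ⟨m, by omega, ?_, ?_⟩
    · exact not_lt.mp (Nat.find_min hex (m := m) (by omega))
    · have := Nat.find_spec hex
      rw [hm] at this
      refine this.trans_eq ?_
      rw [← pow_mul, ← pow_mul, pow_succ]; congr 1; ring
  obtain ⟨X, hX⟩ : ∃ X, X = (2 : ℝ) ^ 2 ^ m := ⟨_, rfl⟩
  have hX1' := hX1 m
  rw [← hX] at hm2 hm3 hX1'
  have hX0 : 0 < X := by linarith
  obtain ⟨j, hj1, hj2, hj3, hj4⟩ : ∃ j : ℕ, j < 2 * K ∧ K ≤ j ∧ X ^ j ≤ T ∧ T < X ^ (j + 1) := by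
    classical
    have hex2 : ∃ k : ℕ, T < X ^ k := ⟨_, hm3⟩
    have hlt : K < Nat.find hex2 := by
      rw [Nat.lt_find_iff]
      intro i hi
      rw [not_lt]
      exact (pow_le_pow_right₀ hX1'.le hi).trans hm2
    obtain ⟨j, hj⟩ := Nat.exists_eq_succ_of_ne_zero (show Nat.find hex2 ≠ 0 by omega)
    have hle := Nat.find_min' hex2 hm3
    refine ⟨j, by omega, by omega, ?_, ?_⟩
    · exact not_lt.mp (Nat.find_min hex2 (m := j) (by omega))
    · have := Nat.find_spec hex2
      rwa [hj] at this
  obtain ⟨Y, hY⟩ : ∃ Y, Y = T ^ (1 / K : ℝ) := ⟨_, rfl⟩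
  have hKR : (0 : ℝ) < K := by exact_mod_cast hK
  have hXY : X ≤ Y := by
    rw [hY]
    calc X = (X ^ K) ^ (1 / K : ℝ) := by
          rw [one_div, Real.pow_rpow_inv_natCast hX0.le hK.ne']
      _ ≤ _ := Real.rpow_le_rpow (by positivity) hm2 (by positivity)
  have hY1 : 1 ≤ Y := hX1'.le.trans hXY
  have hTY : T ^ 2 * Y ^ 3 = (2 * D) ^ (2 + 3 / K : ℝ) * (q : ℝ) ^ (2 + 3 / K : ℝ) := by
    rw [← Real.mul_rpow (by positivity) (by positivity), ← hT, Real.rpow_add hT0, hY,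
      ← Real.rpow_natCast (T ^ (1 / K : ℝ)) 3, ← Real.rpow_mul hT0.le]
    congr 1
    · norm_num
    · congr 1; push_cast; ring
  have hgoal : 1 / (4 * D * (2 * D) ^ (2 + 3 / K : ℝ)) / (q : ℝ) ^ (2 + 3 / K : ℝ)
      = 1 / (4 * D * (T ^ 2 * Y ^ 3)) := by
    rw [hTY, div_div]; congr 1; ring
  rw [hgoal]
  obtain ⟨u, v, h1, h2, h3⟩ := h j m ((hmn j hj1).trans hm1)
  rw [← hX] at h1 h2 h3
  have hCj := hCD j hj1
  have h1' : |(u : ℝ)| ≤ D * X ^ (j + 1 + 1) :=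
    h1.trans (mul_le_mul_of_nonneg_right hCj (by positivity))
  have h3' : |u * fm_f (1 / 2) - v| ≤ D / X ^ (j + 1) :=
    h3.trans (div_le_div_of_nonneg_right hCj (by positivity))
  have hq0R : (0 : ℝ) < q := by linarith
  generalize fm_f (1 / 2) = α at *
  have hXj : 0 < X ^ j := by positivity
  by_cases hcase : u * p = v * q
  · have hcR : (u : ℝ) * p = v * q := by exact_mod_cast hcase
    have hpos : 0 < |(u : ℝ) * α - v| := lt_of_lt_of_le (by positivity) h2
    have hu : (u : ℝ) ≠ 0 := by
      intro h0
      rw [h0, zero_mul] at hcR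
      have : (v : ℝ) = 0 := (mul_eq_zero.mp hcR.symm).resolve_right hq0R.ne'
      rw [h0, this] at hpos
      simp at hpos
    have e : α - p / q = (u * α - v) / u := by
      field_simp
      linear_combination -hcR
    rw [e, abs_div]
    have hu' : 0 < |(u : ℝ)| := abs_pos.mpr hu
    calc 1 / (4 * D * (T ^ 2 * Y ^ 3)) ≤ 1 / (4 * D * ((X ^ j) ^ 2 * X ^ 3)) := by gcongr
      _ = 1 / (4 * X ^ (j + 1)) / (D * X ^ (j + 1 + 1)) := by rw [div_div]; congr 1; ring
      _ ≤ _ := by gcongr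
  · have hint : (1 : ℝ) ≤ |(u : ℝ) * p - v * q| := by
      have : (1 : ℤ) ≤ |u * p - v * q| := Int.one_le_abs (sub_ne_zero.mpr hcase)
      exact_mod_cast this
    have e : (u : ℝ) * p - v * q = q * (u * α - v) - u * (q * (α - p / q)) := by
      field_simp; ring
    have i1 : |(u : ℝ) * p - v * q| ≤ q * |u * α - v| + |(u : ℝ)| * (q * |α - p / q|) := by
      rw [e]
      refine (abs_sub _ _).trans ?_
      rw [abs_mul, abs_mul, abs_mul, abs_of_pos hq0R]
    have i2 : q * |u * α - v| ≤ 1 / 2 := by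
      calc q * |u * α - v| ≤ q * (D / X ^ (j + 1)) := by gcongr
        _ = (T / X ^ (j + 1)) / 2 := by rw [hT]; ring
        _ ≤ 1 / 2 := by
          gcongr
          rw [div_le_one (by positivity)]; exact hj4.le
    have i3 : 1 / 2 ≤ |(u : ℝ)| * (q * |α - p / q|) := by linarith
    have i4 : |(u : ℝ)| * (q * |α - p / q|) ≤ D * (T * Y ^ 2) * (q * |α - p / q|) := by
      have : X ^ (j + 1 + 1) = X ^ j * X ^ 2 := by ring
      rw [this] at h1'
      refine mul_le_mul_of_nonneg_right (h1'.trans ?_) (by positivity)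
      gcongr
    have i5 : D * (T * Y ^ 2) * (q * |α - p / q|) = (T ^ 2 * Y ^ 2) * |α - p / q| / 2 := by
      rw [hT]; ring
    have i6 : 1 ≤ (T ^ 2 * Y ^ 2) * |α - p / q| := by linarith
    rw [div_le_iff₀ (by positivity)]
    have i7 : T ^ 2 * Y ^ 2 ≤ 4 * D * (T ^ 2 * Y ^ 3) := by
      have : T ^ 2 * Y ^ 2 ≤ T ^ 2 * Y ^ 3 := by gcongr; norm_num
      have : 0 ≤ T ^ 2 * Y ^ 3 := by positivity
      nlinarith
    calc 1 ≤ (T ^ 2 * Y ^ 2) * |α - p / q| := i6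
      _ ≤ 4 * D * (T ^ 2 * Y ^ 3) * |α - p / q| := by gcongr
      _ = _ := by ring

theorem fm_irr : Irrational (fm_f (1 / 2)) := by
  rintro ⟨r, hr⟩
  obtain ⟨c, q0, hc, h⟩ := fm_lower 1 one_pos
  have hd : 0 < r.den := r.den_pos
  have := h (r.den * (q0 + 1)) (by nlinarith) (by positivity) (r.num * (q0 + 1))
  have e : fm_f (1 / 2) - ((r.num * (q0 + 1) : ℤ) : ℝ) / ((r.den * (q0 + 1) : ℕ) : ℝ) = 0 := by
    rw [← hr]
    push_cast
    have hd' : (r.den : ℝ) ≠ 0 := by positivity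
    have hq' : ((q0 : ℝ) + 1) ≠ 0 := by positivity
    rw [mul_div_mul_right _ _ hq', Rat.cast_def r, sub_self]
  rw [e, abs_zero] at this
  have hp : 0 < c / (((r.den * (q0 + 1) : ℕ) : ℝ) ^ (2 + 3 / (1 : ℕ) : ℝ)) := by positivity
  linarith

theorem fm_upper (μ : ℝ) (hμ : 2 < μ) :
    {pq : ℤ × ℕ | 0 < pq.2 ∧ |fm_f (1 / 2) - (pq.1 : ℝ) / (pq.2 : ℝ)| < 1 / (pq.2 : ℝ) ^ μ}.Finite := by
  obtain ⟨K, hK⟩ := exists_nat_gt (3 / (μ - 2))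
  have hμ2 : 0 < μ - 2 := by linarith
  have hKR : (0 : ℝ) < K := lt_trans (by positivity) hK
  have hK0 : 0 < K := by exact_mod_cast hKR
  have h3K : 3 / (K : ℝ) < μ - 2 := by
    rw [div_lt_iff₀ hμ2] at hK
    rw [div_lt_iff₀ hKR]; linarith
  obtain ⟨c, q0, hc, h⟩ := fm_lower K hK0
  obtain ⟨δ, hδ⟩ : ∃ δ, δ = μ - (2 + 3 / K) := ⟨_, rfl⟩
  have hδ0 : 0 < δ := by rw [hδ]; linarith
  obtain ⟨M, hM⟩ := exists_nat_gt ((1 / c) ^ (1 / δ))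
  have hqb : ∀ pq : ℤ × ℕ, 0 < pq.2 →
      |fm_f (1 / 2) - (pq.1 : ℝ) / (pq.2 : ℝ)| < 1 / (pq.2 : ℝ) ^ μ → pq.2 ≤ M + q0 := by
    rintro ⟨p, q⟩ hq0 hlt
    simp only at hq0 hlt ⊢
    by_contra hcon
    have h1 := (h q (by omega) hq0 p).trans_lt hlt
    have hqR : (0 : ℝ) < q := by exact_mod_cast hq0
    rw [div_lt_div_iff₀ (by positivity) (by positivity), one_mul] at h1
    have e : (q : ℝ) ^ μ = q ^ δ * q ^ (2 + 3 / K : ℝ) := by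
      rw [← Real.rpow_add hqR, hδ]; congr 1; ring
    rw [e, ← mul_assoc] at h1
    have hp : 0 < (q : ℝ) ^ (2 + 3 / K : ℝ) := by positivity
    have h2 : c * (q : ℝ) ^ δ < 1 := by
      by_contra h3
      rw [not_lt] at h3
      nlinarith
    have h3 : (q : ℝ) ^ δ < 1 / c := by rw [lt_div_iff₀ hc]; linarith
    have h4 := Real.rpow_lt_rpow (by positivity) h3 (show 0 < 1 / δ by positivity)
    rw [← Real.rpow_mul hqR.le, mul_one_div_cancel hδ0.ne', Real.rpow_one] at h4
    have : q < M := by exact_mod_cast h4.trans hM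
    omega
  obtain ⟨B, hB⟩ := exists_nat_gt (((M + q0 : ℕ) : ℝ) * (|fm_f (1 / 2)| + 1))
  refine Set.Finite.subset ((Set.finite_Icc (-(B : ℤ)) B).prod (Set.finite_Iic (M + q0))) ?_
  rintro ⟨p, q⟩ ⟨hq0, hlt⟩
  have hqM := hqb (p, q) hq0 hlt
  simp only at hq0 hlt hqM
  refine ⟨?_, hqM⟩
  have hqR : (1 : ℝ) ≤ q := by exact_mod_cast hq0
  have hqR0 : (0 : ℝ) < q := by linarith
  have h1 : 1 / (q : ℝ) ^ μ ≤ 1 := by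
    rw [div_le_one (by positivity)]
    exact Real.one_le_rpow hqR (by linarith)
  have h2 : |(p : ℝ) / q| ≤ |fm_f (1 / 2)| + 1 := by
    have := abs_sub_abs_le_abs_sub ((p : ℝ) / q) (fm_f (1 / 2))
    rw [abs_sub_comm] at this
    linarith
  rw [abs_div, abs_of_pos hqR0, div_le_iff₀ hqR0] at h2
  have h3 : |(p : ℝ)| < B := by
    refine lt_of_le_of_lt (h2.trans ?_) hB
    rw [mul_comm]
    have : (q : ℝ) ≤ ((M + q0 : ℕ) : ℝ) := by exact_mod_cast hqM
    gcongr
  have h4 : |p| < (B : ℤ) := by exact_mod_cast h3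
  rw [abs_lt] at h4
  exact ⟨h4.1.le, h4.2.le⟩

theorem fm_two :
    {pq : ℤ × ℕ | 0 < pq.2 ∧
      |fm_f (1 / 2) - (pq.1 : ℝ) / (pq.2 : ℝ)| < 1 / (pq.2 : ℝ) ^ (2 : ℝ)}.Infinite := by
  have h := Real.infinite_rat_abs_sub_lt_one_div_den_sq_of_irrational fm_irr
  have hinj : Function.Injective (fun r : ℚ => (r.num, r.den)) := by
    intro a b hab
    simp only [Prod.mk.injEq] at hab
    exact Rat.ext hab.1 hab.2
  refine (h.image hinj.injOn).mono ?_
  rintro _ ⟨r, hr, rfl⟩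
  refine ⟨r.den_pos, ?_⟩
  simp only [Set.mem_ofPred_eq] at hr ⊢
  rw [Real.rpow_two, ← Rat.cast_def r]
  exact hr

theorem irrationalityExponent_sum_reciprocals_fermat :
    irrationalityExponent (∑' n : ℕ, 1 / ((2 : ℝ) ^ 2 ^ n + 1)) = 2 := by
  rw [fm_alpha, irrationalityExponent]
  apply IsGreatest.csSup_eq
  refine ⟨fm_two, ?_⟩
  intro μ hμ
  by_contra hlt
  exact hμ (fm_upper μ (not_le.mp hlt))
end

section
/- For every n ≥ 1, the determinant of the Hankel matrix H_n^1(g) is nonzero, where g is the ruler function g(n) = ν₂(2n). -/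
/-- The Hankel matrix `H_n^p(u)` of a sequence `u`: the `n × n` matrix whose
`(i, j)` entry (for `1 ≤ i, j ≤ n`) is `u (p + i + j - 2)`. -/
def hankelMatrix (n p : ℕ) (u : ℕ → ℤ) : Matrix (Fin n) (Fin n) ℤ :=
  Matrix.of fun i j => u (p + i + j)

/-- The ruler function `g(n) = ν₂(2n)`. -/
def ruler (n : ℕ) : ℤ := (padicValNat 2 (2 * n) : ℤ)

open Polynomial in
lemma rul_descent (d : ℕ) : ∀ A B : (ZMod 2)[X], B.natDegree ≤ d →
    (X + 1) * (A ^ 2 + A * B) = X * B ^ 2 → B = 0 := by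
  have hp : Prime (X + 1 : (ZMod 2)[X]) := by
    have := Polynomial.prime_X_sub_C (1 : ZMod 2)
    have e : (X - C 1 : (ZMod 2)[X]) = X + 1 := by
      rw [CharTwo.sub_eq_add]; simp
    rwa [e] at this
  have h0 : (X + 1 : (ZMod 2)[X]) ≠ 0 := hp.ne_zero
  have hX : ¬ (X + 1 : (ZMod 2)[X]) ∣ X := by
    intro h
    have h1 : (X + 1 : (ZMod 2)[X]) ∣ 1 := (Nat.cast_one (R := (ZMod 2)[X])) ▸ by
      simpa using (dvd_sub (dvd_refl (X + 1 : (ZMod 2)[X])) h)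
    exact hp.not_isUnit (isUnit_of_dvd_one h1)
  have hdeg : (X + 1 : (ZMod 2)[X]).natDegree = 1 := by
    simpa using natDegree_X_add_C (1 : ZMod 2)
  induction d using Nat.strong_induction_on with
  | _ d ih =>
    intro A B hB h
    by_contra hne
    have hd : (X + 1 : (ZMod 2)[X]) ∣ B := by
      have : (X + 1 : (ZMod 2)[X]) ∣ X * B ^ 2 := ⟨_, h.symm⟩
      rcases hp.dvd_or_dvd this with h | h
      · exact absurd h hX
      · exact hp.dvd_of_dvd_pow h
    obtain ⟨E, rfl⟩ := hd
    have h2 : A ^ 2 = (X + 1) * (X * E ^ 2 - A * E) := by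
      apply mul_left_cancel₀ h0
      linear_combination h
    obtain ⟨D, rfl⟩ := hp.dvd_of_dvd_pow (Dvd.intro _ h2.symm)
    have hE : E ≠ 0 := right_ne_zero_of_mul hne
    rw [natDegree_mul h0 hE, hdeg] at hB
    apply hE
    refine ih E.natDegree (by omega) D E le_rfl ?_
    apply mul_left_cancel₀ h0
    linear_combination h2

lemma ruler_odd (k : ℕ) : ruler (2 * k + 1) = 1 := by
  unfold ruler
  rw [padicValNat.mul (by norm_num) (by omega), padicValNat.eq_zero_of_not_dvd (n := 2*k+1) (by omega)]
  simp

lemma ruler_even (k : ℕ) (hk : k ≠ 0) : ruler (2 * k) = 1 + ruler k := by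
  unfold ruler
  rw [padicValNat.mul (a := 2) (b := 2 * k) (by norm_num) (by omega)]
  simp

open PowerSeries in
noncomputable def rulG : PowerSeries (ZMod 2) := PowerSeries.mk fun m => (ruler m : ZMod 2)

lemma rulG_eq : (1 + PowerSeries.X) * (rulG ^ 2 + rulG) = PowerSeries.X := by
  have hs : rulG ^ 2 + rulG = PowerSeries.mk fun m => if m = 0 then (0 : ZMod 2) else 1 := by
    have h := MvPowerSeries.map_frobenius_expand (σ := Unit) (R := ZMod 2) 2 two_ne_zero (f := rulG)
    rw [ZMod.frobenius_zmod, MvPowerSeries.map_id] at h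
    have h' : PowerSeries.expand 2 two_ne_zero rulG = rulG ^ 2 := h
    rw [← h']
    ext m
    rw [map_add]
    rcases Nat.even_or_odd' m with ⟨k, rfl | rfl⟩
    · simp only [PowerSeries.coeff_expand_mul, rulG, PowerSeries.coeff_mk]
      rcases eq_or_ne k 0 with rfl | hk
      · simp [ruler]
      · rw [ruler_even k hk]
        simp [hk]
        rw [add_left_comm, CharTwo.add_self_eq_zero, add_zero]
    · simp only [rulG, PowerSeries.coeff_mk]
      rw [PowerSeries.coeff_expand_of_not_dvd _ _ _ (by omega), ruler_odd]
      simp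
  rw [hs]
  ext m
  rw [add_mul, one_mul, map_add]
  rcases m with _ | _ | m
  · simp
  · simp [PowerSeries.coeff_succ_X_mul]
  · rw [PowerSeries.coeff_succ_X_mul]
    simp [PowerSeries.coeff_X]
    exact CharTwo.add_self_eq_zero _

open Polynomial in
lemma rul_key (n : ℕ) (hn : 1 ≤ n) (B : (ZMod 2)[X]) (hB : B.degree < n)
    (h : ∀ i < n, PowerSeries.coeff (n + i) ((B : PowerSeries (ZMod 2)) * rulG) = 0) : B = 0 := by
  set F := (B : PowerSeries (ZMod 2)) * rulG with hF
  set A := F.trunc (2 * n) with hA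
  have hAd : A.degree < n := by
    rw [degree_lt_iff_coeff_zero]
    intro m hm
    rw [hA, PowerSeries.coeff_trunc]
    split_ifs with h1
    · obtain ⟨i, rfl⟩ := Nat.exists_eq_add_of_le hm
      exact h i (by omega)
    · rfl
  obtain ⟨R, hR⟩ : ∃ R : PowerSeries (ZMod 2), F = PowerSeries.X ^ (2 * n) * R + (A : PowerSeries (ZMod 2)) :=
    ⟨_, PowerSeries.eq_X_pow_mul_shift_add_trunc (2 * n) F⟩
  have key : (X + 1) * (A ^ 2 + A * B) - X * B ^ 2 = 0 := by
    have hdvd : ∃ S : PowerSeries (ZMod 2), (((X + 1) * (A ^ 2 + A * B) - X * B ^ 2 : (ZMod 2)[X]) : PowerSeries (ZMod 2)) = PowerSeries.X ^ (2 * n) * S := by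
      have hA' : (A : PowerSeries (ZMod 2)) = (B : PowerSeries (ZMod 2)) * rulG - PowerSeries.X ^ (2 * n) * R := by
        rw [← hF, hR]; ring
      have e := rulG_eq
      refine ⟨(1 + PowerSeries.X) * (PowerSeries.X ^ (2 * n) * R ^ 2 - 2 * (B : PowerSeries (ZMod 2)) * rulG * R - R * (B : PowerSeries (ZMod 2))), ?_⟩
      push_cast
      rw [hA']
      linear_combination (B : PowerSeries (ZMod 2)) ^ 2 * e
    obtain ⟨S, hS⟩ := hdvd
    have hAn : A.natDegree ≤ n - 1 := by
      by_cases h : A = 0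
      · simp [h]
      · have := (natDegree_lt_iff_degree_lt h).2 hAd; omega
    have hBn : B.natDegree ≤ n - 1 := by
      by_cases h : B = 0
      · simp [h]
      · have := (natDegree_lt_iff_degree_lt h).2 hB; omega
    have hdeg : ((X + 1) * (A ^ 2 + A * B) - X * B ^ 2 : (ZMod 2)[X]).natDegree ≤ 1 + ((n-1) + (n-1)) := by
      have h1 : (X + 1 : (ZMod 2)[X]).natDegree ≤ 1 := by
        simpa using (natDegree_X_add_C (1 : ZMod 2)).le
      simp only [pow_two]
      have h3 := natDegree_add_le_of_le (natDegree_mul_le_of_le hAn hAn)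
        (natDegree_mul_le_of_le hAn hBn)
      have h4 := natDegree_sub_le_of_le (natDegree_mul_le_of_le h1 h3)
        (natDegree_mul_le_of_le natDegree_X_le (natDegree_mul_le_of_le hBn hBn))
      simpa using h4
    ext m
    by_cases hm : m < 2 * n
    · rw [← Polynomial.coeff_coe, hS, PowerSeries.coeff_X_pow_mul']
      simp [hm]
    · rw [coeff_eq_zero_of_natDegree_lt (by omega)]; simp
  exact rul_descent B.natDegree A B le_rfl (sub_eq_zero.1 key)

open Polynomial in
theorem det_hankel_ruler_ne_zero (n : ℕ) (hn : 1 ≤ n) :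
    (hankelMatrix n 1 ruler).det ≠ 0 := by
  intro hdet
  have h2 : ((hankelMatrix n 1 ruler).map (Int.castRingHom (ZMod 2))).det = 0 := by
    have := RingHom.map_det (Int.castRingHom (ZMod 2)) (hankelMatrix n 1 ruler)
    rw [hdet, map_zero] at this
    exact this.symm
  obtain ⟨v, hv, hv0⟩ := Matrix.exists_mulVec_eq_zero_iff.2 h2
  set B : (ZMod 2)[X] := ∑ j : Fin n, C (v j) * X ^ (n - 1 - (j : ℕ)) with hBdef
  have hB0 : B = 0 := by
    apply rul_key n hn B
    · rw [hBdef]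
      rw [← Polynomial.mem_degreeLT]
      refine Submodule.sum_mem _ fun j _ => ?_
      rw [Polynomial.mem_degreeLT]
      refine (degree_C_mul_X_pow_le _ _).trans_lt ?_
      exact_mod_cast (by omega : n - 1 - (j : ℕ) < n)
    · intro i hi
      have := congrFun hv0 ⟨i, hi⟩
      rw [hBdef, ← Polynomial.coeToPowerSeries.ringHom_apply, map_sum, Finset.sum_mul, map_sum]
      simp only [Matrix.mulVec, dotProduct, Pi.zero_apply] at this
      rw [← this]
      refine Finset.sum_congr rfl fun j _ => ?_
      have hj := j.2
      rw [Polynomial.coeToPowerSeries.ringHom_apply]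
      push_cast
      rw [mul_assoc, PowerSeries.coeff_C_mul, PowerSeries.coeff_X_pow_mul', if_pos (by omega)]
      rw [show n + i - (n - 1 - (j : ℕ)) = 1 + i + j by omega]
      simp [rulG, hankelMatrix, mul_comm]
  apply hv
  ext j
  have hc := congrArg (fun p => Polynomial.coeff p (n - 1 - (j : ℕ))) hB0
  simp only [hBdef, finsetSum_coeff, coeff_C_mul, coeff_X_pow, coeff_zero] at hc
  rw [Finset.sum_eq_single j] at hc
  · simpa using hc
  · intro b _ hb
    have h1 := b.2
    have h2 := j.2
    have : (b : ℕ) ≠ j := fun h => hb (Fin.ext h)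
    rw [if_neg (by omega), mul_zero]
  · simp
end

section
/- For every n ≥ 1, the determinant of the Hankel matrix H_n^1(f) is nonzero, where f(n) is the n-th coefficient of the power series F(z) = Σ_{k≥0} z^{2^k}/(1 + z^{2^k}) = Σ_{n≥1} f(n) z^n. -/
/-- The coefficient sequence of `F(z) = Σ_{k≥0} z^{2^k}/(1 + z^{2^k}) = Σ_{n≥1} f(n) zⁿ`:
explicitly, `f(n) = Σ_{k ≥ 0, 2^k ∣ n} (-1)^(n / 2^k - 1)`. -/
def fermatCoeff (n : ℕ) : ℤ :=
  ∑ k ∈ Finset.range (n + 1), if 2 ^ k ∣ n then (-1 : ℤ) ^ (n / 2 ^ k - 1) else 0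

open Polynomial in
lemma fermat_desc : ∀ (d : ℕ) (A B : (ZMod 2)[X]), A.natDegree ≤ d →
    X * A ^ 2 + (1 + X) * (A * B + B ^ 2) = 0 → A = 0 := by
  have two : (2 : (ZMod 2)[X]) = 0 := CharTwo.two_eq_zero
  have hY : (1 + X : (ZMod 2)[X]) = X - C 1 := by
    rw [C_1]; linear_combination two
  have hY0 : (X - C 1 : (ZMod 2)[X]) ≠ 0 := X_sub_C_ne_zero 1
  intro d
  induction d using Nat.strong_induction_on with
  | _ d ih =>
    intro A B hd h
    by_contra hA
    have hA1 : A.eval 1 = 0 := by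
      have := congrArg (eval 1) h
      rw [hY] at this
      simpa using this
    obtain ⟨A', rfl⟩ := (dvd_iff_isRoot (p := A) (a := (1 : ZMod 2))).2 hA1
    have h2 : (X - C 1) * (X * (X - C 1) * A' ^ 2 + (X - C 1) * A' * B + B ^ 2) = 0 := by
      rw [← h, hY]; ring
    have h3 := (mul_eq_zero.1 h2).resolve_left hY0
    have hB1 : B.eval 1 = 0 := by
      have := congrArg (eval 1) h3
      simpa using this
    obtain ⟨B', rfl⟩ := (dvd_iff_isRoot (p := B) (a := (1 : ZMod 2))).2 hB1
    have h4 : (X - C 1) * (X * A' ^ 2 + (1 + X) * (A' * B' + B' ^ 2)) = 0 := by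
      rw [← h3, hY]; ring
    have h5 := (mul_eq_zero.1 h4).resolve_left hY0
    have hA' : A' ≠ 0 := right_ne_zero_of_mul hA
    have hdeg : ((X - C 1) * A' : (ZMod 2)[X]).natDegree = 1 + A'.natDegree := by
      rw [natDegree_mul hY0 hA', natDegree_X_sub_C]
    exact hA' (ih A'.natDegree (by omega) A' B' le_rfl h5)

lemma fermatCoeff_cast (n : ℕ) : ((fermatCoeff n : ℤ) : ZMod 2) =
    ∑ k ∈ Finset.range (n + 1), if 2 ^ k ∣ n then (1 : ZMod 2) else 0 := by
  unfold fermatCoeff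
  have : (-1 : ZMod 2) = 1 := by decide
  push_cast
  simp [this]

lemma fermatCoeff_odd (n : ℕ) (h : ¬ 2 ∣ n) : ((fermatCoeff n : ℤ) : ZMod 2) = 1 := by
  rw [fermatCoeff_cast, Finset.sum_range_succ']
  rw [Finset.sum_eq_zero]
  · simp
  · intro k _
    rw [if_neg]
    intro hk
    exact h ((dvd_pow_self 2 (Nat.succ_ne_zero k)).trans hk)

lemma fermatCoeff_even (m : ℕ) (h : 1 ≤ m) :
    ((fermatCoeff (2 * m) : ℤ) : ZMod 2) = (fermatCoeff m : ℤ) + 1 := by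
  rw [fermatCoeff_cast, fermatCoeff_cast, Finset.sum_range_succ']
  congr 1
  · have e : ∀ k, (2 ^ (k + 1) ∣ 2 * m) ↔ 2 ^ k ∣ m := by
      intro k
      rw [pow_succ', Nat.mul_dvd_mul_iff_left (by norm_num)]
    simp only [e]
    symm
    apply Finset.sum_subset
    · intro k; simp only [Finset.mem_range]; omega
    · intro k _ hk
      simp only [Finset.mem_range] at hk
      rw [if_neg]
      intro hd
      have := Nat.le_of_dvd h hd
      have := Nat.lt_two_pow_self (n := k)
      omega
  · simp

open Polynomial in
lemma fermat_trunc (N : ℕ) (T : (ZMod 2)[X])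
    (hT : ∀ j, T.coeff j = if 1 ≤ j ∧ j < N then ((fermatCoeff j : ℤ) : ZMod 2) else 0) :
    X ^ N ∣ (1 + X) * (T ^ 2 + T) + X := by
  have two : (2 : (ZMod 2)[X]) = 0 := CharTwo.two_eq_zero
  have two' : (2 : ZMod 2) = 0 := by decide
  have key : ∀ j < N, (T ^ 2 + T).coeff j = if j = 0 then 0 else 1 := by
    intro j hj
    rw [← ZMod.expand_card, coeff_add, coeff_expand (by norm_num)]
    by_cases h2 : 2 ∣ j
    · obtain ⟨m, rfl⟩ := h2
      rw [if_pos (Dvd.intro _ rfl), Nat.mul_div_cancel_left _ (by norm_num), hT, hT]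
      rcases Nat.eq_zero_or_pos m with rfl | hm
      · simp
      · rw [if_pos (by omega), if_pos (by omega), if_neg (by omega), fermatCoeff_even m hm]
        linear_combination ((fermatCoeff m : ℤ) : ZMod 2) * two'
    · rw [if_neg h2, hT]
      have : j ≠ 0 := by rintro rfl; simp at h2
      rw [if_pos (by omega), if_neg this, fermatCoeff_odd j h2, zero_add]
  rw [X_pow_dvd_iff]
  intro j hj
  rw [add_mul, one_mul, coeff_add, coeff_add, key j hj]
  rcases j with _ | j
  · simp
  · rw [coeff_X_mul, key j (by omega), coeff_X]
    rcases j with _ | j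
    · simp; exact two'
    · simp; exact two'

theorem det_hankel_fermatCoeff_ne_zero (n : ℕ) (hn : 1 ≤ n) :
    (hankelMatrix n 1 fermatCoeff).det ≠ 0 := by
  classical
  intro hdet
  have hdet2 : ((hankelMatrix n 1 fermatCoeff).map (Int.castRingHom (ZMod 2))).det = 0 := by
    have := RingHom.map_det (Int.castRingHom (ZMod 2)) (hankelMatrix n 1 fermatCoeff)
    rw [hdet, map_zero] at this
    exact this.symm
  obtain ⟨c, hc0, hc⟩ := Matrix.exists_mulVec_eq_zero_iff.2 hdet2
  open Polynomial in
  have two : (2 : (ZMod 2)[X]) = 0 := CharTwo.two_eq_zero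
  let A : Polynomial (ZMod 2) := ∑ j : Fin n, Polynomial.monomial (n - 1 - (j : ℕ)) (c j)
  let T : Polynomial (ZMod 2) := ∑ j ∈ Finset.Ico 1 (2 * n),
    Polynomial.monomial j ((fermatCoeff j : ℤ) : ZMod 2)
  have hT : ∀ j, T.coeff j = if 1 ≤ j ∧ j < 2 * n then ((fermatCoeff j : ℤ) : ZMod 2) else 0 := by
    intro j
    simp only [T, Polynomial.finsetSum_coeff, Polynomial.coeff_monomial]
    rw [Finset.sum_ite_eq']
    simp
  have hAdeg : A.natDegree ≤ n - 1 := by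
    apply Polynomial.natDegree_sum_le_of_forall_le
    intro j _
    exact (Polynomial.natDegree_monomial_le _).trans (by omega)
  have hA0 : A ≠ 0 := by
    intro hA
    apply hc0
    funext j
    have := congrArg (fun p => Polynomial.coeff p (n - 1 - (j : ℕ))) hA
    simp only [A, Polynomial.finsetSum_coeff, Polynomial.coeff_monomial, Polynomial.coeff_zero] at this
    rw [Finset.sum_eq_single j] at this
    · simpa using this
    · intro b _ hb
      rw [if_neg]
      intro h
      apply hb
      apply Fin.ext
      omega
    · simp
  have hAT : ∀ m, n ≤ m → m < 2 * n → (A * T).coeff m = 0 := by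
    intro m h1 h2
    have := congrFun hc ⟨m - n, by omega⟩
    simp only [Matrix.mulVec, dotProduct, hankelMatrix, Matrix.map_apply, Matrix.of_apply,
      Pi.zero_apply] at this
    rw [← this]
    simp only [A, Finset.sum_mul, Polynomial.finsetSum_coeff]
    apply Finset.sum_congr rfl
    intro j _
    have e : m = (1 + (m - n) + (j : ℕ)) + (n - 1 - (j : ℕ)) := by omega
    have : (Polynomial.monomial (n - 1 - (j : ℕ)) (c j) * T).coeff m
        = c j * T.coeff (1 + (m - n) + (j : ℕ)) := by
      conv_lhs => rw [e]
      rw [Polynomial.coeff_monomial_mul]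
    rw [this, hT, if_pos (by omega), mul_comm]
    simp
  let B : Polynomial (ZMod 2) := ∑ j ∈ Finset.range n, Polynomial.monomial j ((A * T).coeff j)
  have hB : ∀ j, B.coeff j = if j < n then (A * T).coeff j else 0 := by
    intro j
    simp only [B, Polynomial.finsetSum_coeff, Polynomial.coeff_monomial]
    rw [Finset.sum_ite_eq']
    simp
  have hBdeg : B.natDegree ≤ n - 1 := by
    apply Polynomial.natDegree_sum_le_of_forall_le
    intro j hj
    have := Finset.mem_range.1 hj
    exact (Polynomial.natDegree_monomial_le _).trans (by omega)
  have hR : (Polynomial.X : Polynomial (ZMod 2)) ^ (2 * n) ∣ A * T - B := by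
    rw [Polynomial.X_pow_dvd_iff]
    intro j hj
    rw [Polynomial.coeff_sub, hB]
    split_ifs with h
    · simp
    · rw [hAT j (by omega) hj]; simp
  obtain ⟨R, hR⟩ := hR
  obtain ⟨S, hS⟩ := fermat_trunc (2 * n) T hT
  have hdvd : (Polynomial.X : Polynomial (ZMod 2)) ^ (2 * n) ∣
      Polynomial.X * A ^ 2 + (1 + Polynomial.X) * (A * B + B ^ 2) := by
    refine ⟨A ^ 2 * S + (1 + Polynomial.X) * R * (A * T + A + B), ?_⟩
    have hS' := hS
    linear_combination A ^ 2 * hS + (1 + Polynomial.X) * (A * T + A + B) * hR -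
      (1 + Polynomial.X) * (A ^ 2 * T ^ 2 + A ^ 2 * T - A * B - B ^ 2) * two
  have hzero : Polynomial.X * A ^ 2 + (1 + Polynomial.X) * (A * B + B ^ 2) = 0 := by
    by_contra hne
    have h1 := Polynomial.natDegree_le_of_dvd hdvd hne
    rw [Polynomial.natDegree_X_pow] at h1
    have h2 : (Polynomial.X * A ^ 2 + (1 + Polynomial.X) * (A * B + B ^ 2)).natDegree
        ≤ 1 + 2 * (n - 1) := by
      apply Polynomial.natDegree_add_le_of_degree_le
      · apply Polynomial.natDegree_mul_le_of_le Polynomial.natDegree_X_le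
        exact Polynomial.natDegree_pow_le_of_le 2 hAdeg
      · apply Polynomial.natDegree_mul_le_of_le
        · apply Polynomial.natDegree_add_le_of_degree_le
          · simp
          · exact Polynomial.natDegree_X_le
        · apply Polynomial.natDegree_add_le_of_degree_le
          · rw [two_mul]; exact Polynomial.natDegree_mul_le_of_le hAdeg hBdeg
          · exact Polynomial.natDegree_pow_le_of_le 2 hBdeg
    omega
  exact hA0 (fermat_desc _ A B le_rfl hzero)
end

section
/- For every n ≥ 1, det H_n^0(g⁰) ≡ 0 (mod 2) if n ≡ 1 or 4 (mod 6), and det H_n^0(g⁰) ≡ 1 (mod 2) if n ≡ 0, 2, 3, or 5 (mod 6), where g⁰ is the ruler function extended by g⁰(0) = 0. -/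
/-- The ruler function `g(n) = ν₂(2n)` extended to index `0` by `g⁰(0) = 0`. -/
def ruler0 (n : ℕ) : ℤ := if n = 0 then 0 else (padicValNat 2 (2 * n) : ℤ)
open PowerSeries in
noncomputable def rf : (ZMod 2)⟦X⟧ := PowerSeries.mk fun k => (ruler0 k : ZMod 2)

lemma ruler0_odd (k : ℕ) (h : k % 2 = 1) : (ruler0 k : ZMod 2) = 1 := by
  have : padicValNat 2 k = 0 := padicValNat.eq_zero_of_not_dvd (by omega)
  have hk : k ≠ 0 := by omega
  simp [ruler0, hk, this]

lemma ruler0_even (k : ℕ) (h : k ≠ 0) : (ruler0 (2*k) : ZMod 2) = 1 + ruler0 k := by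
  simp [ruler0, h]
  ring

lemma rf_sq (k : ℕ) : PowerSeries.coeff k (rf ^ 2) =
    if k % 2 = 0 then PowerSeries.coeff (k/2) rf else 0 := by
  have h := MvPowerSeries.map_frobenius_expand (σ := Unit) (R := ZMod 2) 2 (by norm_num) (f := rf)
  rw [ZMod.frobenius_zmod] at h
  have h' : PowerSeries.expand 2 (by norm_num) rf = rf ^ 2 := by
    refine Eq.trans ?_ h
    rw [MvPowerSeries.map_id]
    rfl
  rw [← h', PowerSeries.coeff_expand]
  simp only [Nat.dvd_iff_mod_eq_zero]

lemma two0 : (2 : PowerSeries (ZMod 2)) = 0 := by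
  have h : (PowerSeries.C (2 : ZMod 2)) = 0 := by
    rw [show (2 : ZMod 2) = 0 from rfl, map_zero]
  rw [← h, map_ofNat]

lemma rf_eq : (1 + PowerSeries.X) * (rf ^ 2 + rf) = PowerSeries.X := by
  have h : ∀ k, PowerSeries.coeff k (rf ^ 2 + rf) = if k = 0 then 0 else 1 := by
    intro k
    rw [map_add, rf_sq]
    rcases Nat.even_or_odd' k with ⟨j, rfl | rfl⟩
    · rcases eq_or_ne j 0 with rfl | hj
      · simp [rf, ruler0]
      · have : (2 * j) % 2 = 0 := by omega
        have h2 : 2 * j / 2 = j := by omega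
        have h3 : 2 * j ≠ 0 := by omega
        rw [if_pos this, h2, if_neg h3]
        simp only [rf, PowerSeries.coeff_mk]
        rw [ruler0_even j hj]
        have : ∀ a : ZMod 2, a + (1 + a) = 1 := by decide
        exact this _
    · have : ¬ (2 * j + 1) % 2 = 0 := by omega
      rw [if_neg this, if_neg (by omega)]
      simp only [rf, PowerSeries.coeff_mk]
      rw [ruler0_odd _ (by omega)]; simp
  ext k
  rw [add_mul, one_mul, map_add, h]
  rcases k with _ | k
  · simp
  · rw [PowerSeries.coeff_succ_X_mul, h, PowerSeries.coeff_X]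
    rcases k with _ | k
    · simp
    · simp; decide

lemma X_dvd_rf : PowerSeries.X ∣ rf := by
  rw [PowerSeries.X_dvd_iff]; simp [rf, ruler0, ← PowerSeries.coeff_zero_eq_constantCoeff_apply]

lemma eps_dvd : (PowerSeries.X : PowerSeries (ZMod 2)) ^ 6 ∣
    (1 + PowerSeries.X) * rf + PowerSeries.X + PowerSeries.X ^ 2 + PowerSeries.X ^ 3 := by
  have h2 := two0
  have e : (1 + PowerSeries.X) * rf + PowerSeries.X + PowerSeries.X ^ 2 + PowerSeries.X ^ 3
    = ((1 + PowerSeries.X) * rf ^ 2) ^ 3 := by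
    have := rf_eq
    grind
  obtain ⟨s, hs⟩ := X_dvd_rf
  rw [e]
  exact ⟨(1 + PowerSeries.X)^3 * s ^ 6, by rw [hs]; ring⟩

lemma base_dvd : (PowerSeries.X : PowerSeries (ZMod 2)) ^ 4 ∣
    (1 + PowerSeries.X ^ 2) * rf + PowerSeries.X := by
  have h2 := two0
  have e : (1 + PowerSeries.X ^ 2) * rf + PowerSeries.X
    = ((1 + PowerSeries.X) * rf ^ 2) ^ 2 := by
    have := rf_eq
    grind
  obtain ⟨s, hs⟩ := X_dvd_rf
  rw [e]
  exact ⟨(1 + PowerSeries.X)^2 * s ^ 4, by rw [hs]; ring⟩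

def PP (a o : ℕ) (A B : Polynomial (ZMod 2)) : Prop :=
  A.degree ≤ a ∧ B.degree < a ∧
    (PowerSeries.X : PowerSeries (ZMod 2)) ^ o ∣ (A : PowerSeries (ZMod 2)) * rf + B ∧
    A.coeff 0 = 1 ∧ B.coeff 0 = 0

open Polynomial in
noncomputable def S1 (A B : (ZMod 2)[X]) : (ZMod 2)[X] := (1 + X ^ 2 + X ^ 3) * A + (1 + X) * B
open Polynomial in
noncomputable def S2 (A B : (ZMod 2)[X]) : (ZMod 2)[X] := X * A + (X + X ^ 2 + X ^ 3) * B

lemma two0p : (2 : Polynomial (ZMod 2)) = 0 := by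
  have h : (Polynomial.C (2 : ZMod 2)) = 0 := by
    rw [show (2 : ZMod 2) = 0 from rfl, map_zero]
  rw [← h, map_ofNat]

lemma S_det (A B C D : Polynomial (ZMod 2)) :
    S1 A B * S2 C D + S2 A B * S1 C D = Polynomial.X ^ 6 * (A * D + B * C) := by
  have := two0p
  unfold S1 S2
  grind

lemma deg_lt_mul {p q : Polynomial (ZMod 2)} {i j k : ℕ} (hp : p.degree ≤ i) (hq : q.degree < j)
    (hk : i + j ≤ k) : (p * q).degree < k := by
  by_cases hp0 : p = 0
  · simp [hp0, bot_lt_iff_ne_bot]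
  by_cases hq0 : q = 0
  · simp [hq0, bot_lt_iff_ne_bot]
  rw [Polynomial.degree_mul]
  rw [Polynomial.degree_eq_natDegree hp0] at *
  rw [Polynomial.degree_eq_natDegree hq0] at *
  norm_cast at *
  omega

lemma lt_le (p : Polynomial (ZMod 2)) (k : ℕ) (hk : p.degree < ((k + 1 : ℕ) : WithBot ℕ)) :
    p.degree ≤ (k : WithBot ℕ) := by
  by_cases hp0 : p = 0
  · simp [hp0]
  rw [Polynomial.degree_eq_natDegree hp0] at *
  norm_cast at *
  omega

lemma PP_step {a o : ℕ} {A B : Polynomial (ZMod 2)} (h : PP a o A B) :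
    PP (a + 3) (o + 6) (S1 A B) (S2 A B) := by
  obtain ⟨h1, h2, h3, h4, h5⟩ := h
  have h1' : A.degree < ((a + 1 : ℕ) : WithBot ℕ) :=
    lt_of_le_of_lt h1 (by norm_cast; omega)
  refine ⟨?_, ?_, ?_, ?_, ?_⟩
  · apply lt_le
    unfold S1
    refine lt_of_le_of_lt (Polynomial.degree_add_le _ _) (max_lt ?_ ?_)
    · exact deg_lt_mul (i := 3) (by compute_degree; norm_num) h1' (by omega)
    · exact deg_lt_mul (i := 1) (by compute_degree; norm_num) h2 (by omega)
  · unfold S2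
    refine lt_of_le_of_lt (Polynomial.degree_add_le _ _) (max_lt ?_ ?_)
    · exact deg_lt_mul (i := 1) (by compute_degree; norm_num) h1' (by omega)
    · exact deg_lt_mul (i := 3) (by compute_degree; norm_num) h2 (by omega)
  · have e : ((S1 A B : Polynomial (ZMod 2)) : PowerSeries (ZMod 2)) * rf +
        ((S2 A B : Polynomial (ZMod 2)) : PowerSeries (ZMod 2))
      = ((A : PowerSeries (ZMod 2)) * rf + (B : PowerSeries (ZMod 2))) *
       ((1 + PowerSeries.X) * rf + PowerSeries.X + PowerSeries.X ^ 2 + PowerSeries.X ^ 3) := by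
      have h2 := two0
      have h3 := rf_eq
      simp only [S1, S2, Polynomial.coe_add, Polynomial.coe_mul, Polynomial.coe_pow,
        Polynomial.coe_X, Polynomial.coe_one]
      grind
    rw [e, pow_add]
    exact mul_dvd_mul h3 eps_dvd
  · simp [S1, Polynomial.mul_coeff_zero, h4, h5]
  · simp [S2, Polynomial.mul_coeff_zero, h4, h5]

lemma PP_base0 : PP 0 1 1 0 := by
  refine ⟨by simp, by simp, ?_, by simp, by simp⟩
  simpa using X_dvd_rf

lemma PP_base1 : PP 2 4 (1 + Polynomial.X ^ 2) Polynomial.X := by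
  refine ⟨by compute_degree; norm_num, ?_, ?_, by simp, by simp⟩
  · rw [Polynomial.degree_X]; norm_num
  · simpa using base_dvd

lemma seq (m : ℕ) {a o a' o' d : ℕ} {A B C D : Polynomial (ZMod 2)} (h : PP a o A B)
    (h' : PP a' o' C D) (hd : A * D + B * C = Polynomial.X ^ d) :
    ∃ A B C D : Polynomial (ZMod 2), PP (3 * m + a) (6 * m + o) A B ∧
      PP (3 * m + a') (6 * m + o') C D ∧ A * D + B * C ≠ 0 := by
  suffices ∃ A B C D : Polynomial (ZMod 2), PP (3 * m + a) (6 * m + o) A B ∧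
      PP (3 * m + a') (6 * m + o') C D ∧ A * D + B * C = Polynomial.X ^ (6 * m + d) by
    obtain ⟨A, B, C, D, h1, h2, h3⟩ := this
    exact ⟨A, B, C, D, h1, h2, by rw [h3]; exact pow_ne_zero _ Polynomial.X_ne_zero⟩
  induction m with
  | zero => exact ⟨A, B, C, D, by simpa using h, by simpa using h', by simpa using hd⟩
  | succ m ih =>
    obtain ⟨A, B, C, D, h1, h2, h3⟩ := ih
    refine ⟨S1 A B, S2 A B, S1 C D, S2 C D, ?_, ?_, ?_⟩
    · convert! PP_step h1 using 1 <;> ring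
    · convert! PP_step h2 using 1 <;> ring
    · rw [S_det, h3]; ring

lemma pp_zero {n a o : ℕ} {A B v p : Polynomial (ZMod 2)} (hn : 2 ≤ n) (h : PP a o A B)
    (ha : a ≤ n) (ho : n + a ≤ o + 1) (hv : v.degree < n) (hp : p.degree < ((n - 1 : ℕ) : WithBot ℕ))
    (hd : (PowerSeries.X : PowerSeries (ZMod 2)) ^ (2 * n - 1) ∣
      (v : PowerSeries (ZMod 2)) * rf + p) : v * B + p * A = 0 := by
  obtain ⟨h1, h2, h3, -, -⟩ := h
  have hd1 : (v * B + p * A).degree < ((n + a - 1 : ℕ) : WithBot ℕ) := by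
    refine lt_of_le_of_lt (Polynomial.degree_add_le _ _) (max_lt ?_ ?_)
    · have hv' : v.degree ≤ ((n - 1 : ℕ) : WithBot ℕ) := by
        obtain ⟨k, rfl⟩ : ∃ k, n = k + 1 := ⟨n - 1, by omega⟩
        exact lt_le _ _ hv
      exact deg_lt_mul hv' h2 (by omega)
    · rw [mul_comm]
      exact deg_lt_mul h1 hp (by omega)
  have hdv : (PowerSeries.X : PowerSeries (ZMod 2)) ^ (n + a - 1) ∣
      ((v * B + p * A : Polynomial (ZMod 2)) : PowerSeries (ZMod 2)) := by
    have e : ((v * B + p * A : Polynomial (ZMod 2)) : PowerSeries (ZMod 2)) =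
      v * (A * rf + B) + A * (v * rf + p) := by
      have := two0
      simp only [Polynomial.coe_add, Polynomial.coe_mul]
      grind
    rw [e]
    exact dvd_add (Dvd.dvd.mul_left ((pow_dvd_pow _ (by omega)).trans h3) _)
      (Dvd.dvd.mul_left ((pow_dvd_pow _ (by omega)).trans hd) _)
  rw [PowerSeries.X_pow_dvd_iff] at hdv
  ext k
  by_cases hk : k < n + a - 1
  · rw [← Polynomial.coeff_coe, hdv k hk]; simp
  · rw [Polynomial.coeff_zero]
    exact Polynomial.coeff_eq_zero_of_degree_lt (hd1.trans_le (by norm_cast; omega))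

noncomputable def HM (n : ℕ) : Matrix (Fin n) (Fin n) (ZMod 2) :=
  Matrix.of fun i j => (ruler0 (i + j) : ZMod 2)

lemma HM_det (n : ℕ) : ((hankelMatrix n 0 ruler0).det : ZMod 2) = (HM n).det := by
  rw [Int.cast_det]
  congr 1
  ext i j
  simp [hankelMatrix, HM]

open Polynomial in
lemma HM_mulVec (n : ℕ) (v : Fin n → ZMod 2) (i : Fin n) :
    (HM n).mulVec v i = PowerSeries.coeff (n - 1 + i)
      (((∑ j : Fin n, C (v j) * X ^ (n - 1 - j : ℕ) : (ZMod 2)[X]) : PowerSeries (ZMod 2)) * rf) := by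
  rw [← Polynomial.coeToPowerSeries.ringHom_apply, map_sum, Finset.sum_mul, map_sum]
  simp only [Matrix.mulVec, dotProduct]
  refine Finset.sum_congr rfl fun j _ => ?_
  simp only [map_mul, map_pow, Polynomial.coeToPowerSeries.ringHom_apply, Polynomial.coe_C,
    Polynomial.coe_X]
  rw [mul_assoc, PowerSeries.coeff_C_mul, PowerSeries.coeff_X_pow_mul', if_pos (by omega)]
  rw [mul_comm]
  simp only [HM, rf, Matrix.of_apply, PowerSeries.coeff_mk]
  congr 3
  omega

open Polynomial in
lemma nonsing {n a o a' o' : ℕ} {A B C D : (ZMod 2)[X]} (hn : 2 ≤ n) (h : PP a o A B)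
    (h' : PP a' o' C D) (hd : A * D + B * C ≠ 0)
    (ha : a ≤ n) (ho : n + a ≤ o + 1) (ha' : a' ≤ n) (ho' : n + a' ≤ o' + 1) :
    (HM n).det ≠ 0 := by
  intro h0
  obtain ⟨v, hv0, hv⟩ := Matrix.exists_mulVec_eq_zero_iff.mpr h0
  set w : (ZMod 2)[X] := ∑ j : Fin n, Polynomial.C (v j) * X ^ (n - 1 - j : ℕ) with hw
  have hwd : w.degree < n := by
    rw [Polynomial.degree_lt_iff_coeff_zero]
    intro k hk
    rw [hw, Polynomial.finsetSum_coeff]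
    refine Finset.sum_eq_zero fun j _ => ?_
    rw [Polynomial.coeff_C_mul_X_pow, if_neg (by omega)]
  have hH : ∀ i : Fin n, PowerSeries.coeff (n - 1 + i) ((w : PowerSeries (ZMod 2)) * rf) = 0 := by
    intro i
    rw [hw, ← HM_mulVec, hv]; rfl
  set p := PowerSeries.trunc (n - 1) ((w : PowerSeries (ZMod 2)) * rf) with hp
  have hpd : p.degree < ((n - 1 : ℕ) : WithBot ℕ) := PowerSeries.degree_trunc_lt _ _
  have hdvd : (PowerSeries.X : PowerSeries (ZMod 2)) ^ (2 * n - 1) ∣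
      (w : PowerSeries (ZMod 2)) * rf + p := by
    rw [PowerSeries.X_pow_dvd_iff]
    intro k hk
    rw [map_add, Polynomial.coeff_coe, hp, PowerSeries.coeff_trunc]
    split_ifs with hkn
    · exact CharTwo.add_self_eq_zero _
    · have := hH ⟨k - (n - 1), by omega⟩
      simp only at this
      rw [show n - 1 + (k - (n - 1)) = k by omega] at this
      rw [this]; simp
  have e1 := pp_zero hn h ha ho hwd hpd hdvd
  have e2 := pp_zero hn h' ha' ho' hwd hpd hdvd
  have e3 : w * (A * D + B * C) = 0 := by
    have := two0p
    linear_combination C * e1 + A * e2 - p * A * C * this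
  have hw0 : w = 0 := (mul_eq_zero.mp e3).resolve_right hd
  apply hv0
  funext i
  have : w.coeff (n - 1 - i) = v i := by
    rw [hw, Polynomial.finsetSum_coeff, Finset.sum_eq_single i]
    · simp
    · intro j _ hj
      rw [Polynomial.coeff_C_mul_X_pow, if_neg]
      intro h
      apply hj; ext; omega
    · simp
  rw [← this, hw0]; simp

open Polynomial in
lemma sing {a : ℕ} {A B : (ZMod 2)[X]} (h : PP a (2 * a + 1) A B) : (HM (a + 1)).det = 0 := by
  obtain ⟨h1, h2, h3, h4, -⟩ := h
  rw [← Matrix.exists_mulVec_eq_zero_iff]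
  refine ⟨fun j => A.coeff (a - j), ?_, ?_⟩
  · intro h
    have := congrFun h (Fin.last a)
    simp [h4] at this
  · funext i
    have hA : (∑ j : Fin (a + 1), Polynomial.C (A.coeff (a - j)) * X ^ (a + 1 - 1 - j : ℕ)) = A := by
      rw [Fin.sum_univ_eq_sum_range (fun j => Polynomial.C (A.coeff (a - j)) * X ^ (a + 1 - 1 - j : ℕ))]
      have := Finset.sum_range_reflect (fun j => Polynomial.C (A.coeff j) * X ^ j) (a + 1)
      simp only [Nat.add_sub_cancel] at this ⊢
      rw [this]
      exact (A.as_sum_range_C_mul_X_pow' (Nat.lt_succ_of_le (natDegree_le_of_degree_le h1))).symm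
    rw [HM_mulVec, hA]
    rw [PowerSeries.X_pow_dvd_iff] at h3
    have := h3 (a + i) (by omega)
    rw [map_add, Polynomial.coeff_coe, Polynomial.coeff_eq_zero_of_degree_lt (n := a + i)
      (h2.trans_le (by norm_cast; omega))] at this
    simpa using this

theorem det_hankel_ruler0_mod_two (n : ℕ) (hn : 1 ≤ n) :
    ((n % 6 = 1 ∨ n % 6 = 4) → (hankelMatrix n 0 ruler0).det ≡ 0 [ZMOD 2]) ∧
    ((n % 6 = 0 ∨ n % 6 = 2 ∨ n % 6 = 3 ∨ n % 6 = 5) →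
      (hankelMatrix n 0 ruler0).det ≡ 1 [ZMOD 2]) := by
  have hdet0 : (1 : Polynomial (ZMod 2)) * Polynomial.X + 0 * (1 + Polynomial.X ^ 2)
      = Polynomial.X ^ 1 := by ring
  have hdet1 : S1 1 0 * Polynomial.X + S2 1 0 * (1 + Polynomial.X ^ 2)
      = Polynomial.X ^ 4 := by
    have := two0p
    unfold S1 S2
    grind
  have one_of : ∀ x : ZMod 2, x ≠ 0 → x = 1 := by decide
  constructor
  · intro h
    have hz : (HM n).det = 0 := by
      obtain ⟨m, rfl⟩ : ∃ m, n = 3 * m + 1 := ⟨n / 3, by omega⟩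
      obtain ⟨A, B, C, D, h1, -, -⟩ := seq m PP_base0 PP_base1 hdet0
      exact sing (a := 3 * m) (A := A) (B := B) (by convert! h1 using 1; ring)
    have := (ZMod.intCast_eq_intCast_iff (hankelMatrix n 0 ruler0).det 0 2).mp
      (by rw [HM_det, hz]; simp)
    exact_mod_cast this
  · intro h
    have hz : (HM n).det ≠ 0 := by
      have : n % 3 = 0 ∨ n % 3 = 2 := by omega
      rcases this with h | h
      · obtain ⟨m, rfl⟩ : ∃ m, n = 3 * m + 3 := ⟨n / 3 - 1, by omega⟩
        obtain ⟨A, B, C, D, h1, h2, h3⟩ := seq m (PP_step PP_base0) PP_base1 hdet1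
        exact nonsing (by omega) h1 h2 h3 (by omega) (by omega) (by omega) (by omega)
      · obtain ⟨m, rfl⟩ : ∃ m, n = 3 * m + 2 := ⟨n / 3, by omega⟩
        obtain ⟨A, B, C, D, h1, h2, h3⟩ := seq m PP_base0 PP_base1 hdet0
        exact nonsing (by omega) h1 h2 h3 (by omega) (by omega) (by omega) (by omega)
    have := (ZMod.intCast_eq_intCast_iff (hankelMatrix n 0 ruler0).det 1 2).mp
      (by rw [HM_det, one_of _ hz]; simp)
    exact_mod_cast this
end
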